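/- arXiv:1507.05896 — 2 statements merged into one kernel-verified Lean document; each statement's English description precedes it below -/
import Mathlib

section
/- We have lim_{K → ∞} (Σ_{M ∈ I₃} η(I − M, 3, K))/(8192·64^{K−3}) = 5087/10752. -/
open Filter

/-- `ord2 K t`: the largest `j ≤ K` such that `t` is divisible by `2^j` in `ℤ/2^Kℤ`
(so `ord2 K 0 = K`). -/
noncomputable def ord2 (K : ℕ) (t : ZMod (2 ^ K)) : ℕ :=
  sSup {j : ℕ | j ≤ K ∧ (2 : ZMod (2 ^ K)) ^ j ∣ t}

/-- For `M = [[α,β,0],[γ,δ,0],[e,f,0]]`, `Af M = γf - δe`. -/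
def Af {n : ℕ} (M : Matrix (Fin 3) (Fin 3) (ZMod n)) : ZMod n :=
  M 1 0 * M 2 1 - M 1 1 * M 2 0

/-- For `M = [[α,β,0],[γ,δ,0],[e,f,0]]`, `Bf M = αf - βe`. -/
def Bf {n : ℕ} (M : Matrix (Fin 3) (Fin 3) (ZMod n)) : ZMod n :=
  M 0 0 * M 2 1 - M 0 1 * M 2 0

/-- For `M = [[α,β,0],[γ,δ,0],[e,f,0]]`, `Cf M = αδ - βγ`. -/
def Cf {n : ℕ} (M : Matrix (Fin 3) (Fin 3) (ZMod n)) : ZMod n :=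
  M 0 0 * M 1 1 - M 0 1 * M 1 0

/-- `eta r K M₀` is the number of `3 × 3` matrices `M` over `ℤ/2^Kℤ` with third column zero,
reducing to `M₀` mod `2^r`, with `ord₂(A(M)) > ord₂(B(M))` and `ord₂(C(M)) > ord₂(B(M))`. -/
noncomputable def eta (r K : ℕ) (M₀ : Matrix (Fin 3) (Fin 3) (ZMod (2 ^ r))) : ℕ :=
  Nat.card {M : Matrix (Fin 3) (Fin 3) (ZMod (2 ^ K)) //
    (∀ i, M i 2 = 0) ∧
    (∀ i j, (((M i j).val : ZMod (2 ^ r))) = M₀ i j) ∧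
    ord2 K (Bf M) < ord2 K (Af M) ∧ ord2 K (Bf M) < ord2 K (Cf M)}
/-- The matrix `[[1,1],[0,1]]` as an element of `GL₂(ℤ/8ℤ)`. -/
def u1 : GL (Fin 2) (ZMod (2 ^ 3)) := ⟨!![1,1;0,1], !![1,7;0,1], by decide, by decide⟩

/-- The matrix `[[7,0],[2,1]]` as an element of `GL₂(ℤ/8ℤ)`. -/
def u2 : GL (Fin 2) (ZMod (2 ^ 3)) := ⟨!![7,0;2,1], !![7,0;2,1], by decide, by decide⟩

/-- The matrix `[[5,0],[2,1]]` as an element of `GL₂(ℤ/8ℤ)`. -/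
def u3 : GL (Fin 2) (ZMod (2 ^ 3)) := ⟨!![5,0;2,1], !![5,0;6,1], by decide, by decide⟩

/-- The subgroup `H` of `GL₂(ℤ/8ℤ)` generated by `[[1,1],[0,1]]`, `[[7,0],[2,1]]`,
`[[5,0],[2,1]]`. -/
def H : Subgroup (GL (Fin 2) (ZMod (2 ^ 3))) := Subgroup.closure {u1, u2, u3}

open scoped Classical in
/-- The group `I₃`, realized as the set of matrices `[[a,b,0],[c,d,0],[e,f,1]]` over `ℤ/8ℤ`
with `[[a,b],[c,d]] ∈ H`, and `e` even if and only if `ad - bc ≡ 1, 7 (mod 8)`. -/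
noncomputable def I3 : Finset (Matrix (Fin 3) (Fin 3) (ZMod (2 ^ 3))) :=
  Finset.univ.filter (fun g =>
    g 0 2 = 0 ∧ g 1 2 = 0 ∧ g 2 2 = 1 ∧
    (∃ h ∈ H, ∀ i j : Fin 2,
      (h : Matrix (Fin 2) (Fin 2) (ZMod (2 ^ 3))) i j = g i.castSucc j.castSucc) ∧
    ((2 : ZMod (2 ^ 3)) ∣ g 2 0 ↔
      g 0 0 * g 1 1 - g 0 1 * g 1 0 ∈ ({1, 7} : Set (ZMod (2 ^ 3)))))

/-- the three minors and the goodness predicate on integer 6-tuples -/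
def zA (N : Fin 6 → ℤ) : ℤ := N 2 * N 5 - N 3 * N 4
def zB (N : Fin 6 → ℤ) : ℤ := N 0 * N 5 - N 1 * N 4
def zC (N : Fin 6 → ℤ) : ℤ := N 0 * N 3 - N 1 * N 2

def Good (K : ℕ) (N : Fin 6 → ℤ) : Prop :=
  ∃ k, k < K ∧ (2 ^ k ∣ zB N ∧ ¬ 2 ^ (k + 1) ∣ zB N ∧ 2 ^ (k + 1) ∣ zA N ∧ 2 ^ (k + 1) ∣ zC N)

/-- undetermined at level `r` -/
def Und (r : ℕ) (N : Fin 6 → ℤ) : Prop :=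
  2 ^ r ∣ zB N ∧ 2 ^ r ∣ zA N ∧ 2 ^ r ∣ zC N

open scoped Classical in
noncomputable def cnt (r m K : ℕ) (N : Fin 6 → ℤ) : ℝ :=
  ∑ X : Fin 6 → Fin (2 ^ m), if Good K (fun i => N i + 2 ^ r * ((X i : ℕ) : ℤ)) then 1 else 0

def splitEquiv (m : ℕ) : (Fin 6 → Fin (2 ^ m)) × (Fin 6 → Fin 2) ≃ (Fin 6 → Fin (2 ^ (m + 1))) :=
  (Equiv.arrowProdEquivProdArrow (Fin 6) (fun _ => Fin (2 ^ m)) (fun _ => Fin 2)).symm.trans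
    (Equiv.arrowCongr (Equiv.refl _) finProdFinEquiv)

lemma cnt_succ (r m K : ℕ) (N : Fin 6 → ℤ) :
    cnt r (m + 1) K N =
      ∑ ε : Fin 6 → Fin 2, cnt (r + 1) m K (fun i => N i + 2 ^ r * ((ε i : ℕ) : ℤ)) := by
  unfold cnt
  rw [← (splitEquiv m).sum_comp, Fintype.sum_prod_type_right]
  refine Finset.sum_congr rfl fun ε _ => Finset.sum_congr rfl fun X _ => ?_
  have : (fun i => N i + 2 ^ r * (((splitEquiv m (X, ε)) i : ℕ) : ℤ)) =
      (fun i => N i + 2 ^ r * ((ε i : ℕ) : ℤ) + 2 ^ (r + 1) * ((X i : ℕ) : ℤ)) := by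
    funext i
    have : ((splitEquiv m (X, ε)) i : ℕ) = (ε i : ℕ) + 2 * (X i : ℕ) := rfl
    rw [this]; push_cast; ring
  rw [this]

lemma zB_mod (r : ℕ) (N X : Fin 6 → ℤ) : ∃ t, zB (fun i => N i + 2 ^ r * X i) = zB N + 2 ^ r * t :=
  ⟨N 0 * X 5 + X 0 * N 5 + 2 ^ r * X 0 * X 5 - (N 1 * X 4 + X 1 * N 4 + 2 ^ r * X 1 * X 4), by
    simp only [zB]; ring⟩
lemma zA_mod (r : ℕ) (N X : Fin 6 → ℤ) : ∃ t, zA (fun i => N i + 2 ^ r * X i) = zA N + 2 ^ r * t :=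
  ⟨N 2 * X 5 + X 2 * N 5 + 2 ^ r * X 2 * X 5 - (N 3 * X 4 + X 3 * N 4 + 2 ^ r * X 3 * X 4), by
    simp only [zA]; ring⟩
lemma zC_mod (r : ℕ) (N X : Fin 6 → ℤ) : ∃ t, zC (fun i => N i + 2 ^ r * X i) = zC N + 2 ^ r * t :=
  ⟨N 0 * X 3 + X 0 * N 3 + 2 ^ r * X 0 * X 3 - (N 1 * X 2 + X 1 * N 2 + 2 ^ r * X 1 * X 2), by
    simp only [zC]; ring⟩

lemma dvd_shift {j r : ℕ} (h : j ≤ r) (a t : ℤ) : (2 : ℤ) ^ j ∣ a + 2 ^ r * t ↔ 2 ^ j ∣ a :=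
  dvd_add_left ((pow_dvd_pow 2 h).mul_right t)

lemma good_shift {r : ℕ} (N X : Fin 6 → ℤ) :
    Good r (fun i => N i + 2 ^ r * X i) ↔ Good r N := by
  obtain ⟨a, ha⟩ := zA_mod r N X
  obtain ⟨b, hb⟩ := zB_mod r N X
  obtain ⟨c, hc⟩ := zC_mod r N X
  unfold Good
  refine exists_congr fun k => and_congr_right fun hk => ?_
  rw [ha, hb, hc, dvd_shift (by omega), dvd_shift (by omega), dvd_shift (by omega),
    dvd_shift (by omega)]

lemma und_shift {r : ℕ} (N X : Fin 6 → ℤ) :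
    Und r (fun i => N i + 2 ^ r * X i) ↔ Und r N := by
  obtain ⟨a, ha⟩ := zA_mod r N X
  obtain ⟨b, hb⟩ := zB_mod r N X
  obtain ⟨c, hc⟩ := zC_mod r N X
  unfold Und
  rw [ha, hb, hc, dvd_shift le_rfl, dvd_shift le_rfl, dvd_shift le_rfl]

lemma Good.mono {r K : ℕ} (h : r ≤ K) {N : Fin 6 → ℤ} : Good r N → Good K N := by
  rintro ⟨k, hk, h'⟩
  exact ⟨k, by omega, h'⟩

lemma good_or_und {r K : ℕ} {N : Fin 6 → ℤ} (h : Good K N) : Good r N ∨ Und r N := by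
  obtain ⟨k, hk, h1, h2, h3, h4⟩ := h
  by_cases hkr : k < r
  · exact Or.inl ⟨k, hkr, h1, h2, h3, h4⟩
  · right
    exact ⟨(pow_dvd_pow 2 (by omega)).trans h1, (pow_dvd_pow 2 (by omega)).trans h3,
      (pow_dvd_pow 2 (by omega)).trans h4⟩

lemma not_good_of_und {r : ℕ} {N : Fin 6 → ℤ} (h : Und r N) : ¬ Good r N := by
  rintro ⟨k, hk, h1, h2, h3, h4⟩
  exact h2 ((pow_dvd_pow 2 (by omega)).trans h.1)

lemma Good.even {K : ℕ} {N : Fin 6 → ℤ} (h : Good K N) : 2 ∣ N 2 ∧ 2 ∣ N 3 := by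
  obtain ⟨k, hk, ⟨b, h1⟩, h2, ⟨a, h3⟩, ⟨c, h4⟩⟩ := h
  have hb : ¬ (2 : ℤ) ∣ b := fun ⟨t, ht⟩ => h2 ⟨t, by rw [h1, ht]; ring⟩
  have hk : (2 : ℤ) ^ k ≠ 0 := by positivity
  have key : ∀ x y z : ℤ, zB N * x = zA N * y + zC N * z → (2 : ℤ) ∣ x := by
    intro x y z e
    rw [h1, h3, h4] at e
    have e2 : b * x = 2 * (a * y + c * z) := by
      apply mul_left_cancel₀ hk; rw [← mul_assoc, e]; ring
    exact (Int.prime_two.dvd_or_dvd (Dvd.intro _ e2.symm)).resolve_left hb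
  constructor
  · exact key _ (N 0) (N 4) (by simp only [zA, zB, zC]; ring)
  · exact key _ (N 1) (N 5) (by simp only [zA, zB, zC]; ring)

lemma cnt_full {r m K : ℕ} {N : Fin 6 → ℤ} (hK : r ≤ K) (h : Good r N) : cnt r m K N = 64 ^ m := by
  unfold cnt
  rw [Finset.sum_congr rfl (g := fun _ => (1 : ℝ))]
  · simp [← pow_mul]
    rw [mul_comm, pow_mul]; norm_num
  · intro X _
    rw [if_pos (((good_shift N _).2 h).mono hK)]

lemma cnt_zero {r m K : ℕ} {N : Fin 6 → ℤ} (h1 : ¬ Good r N) (h2 : ¬ Und r N) :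
    cnt r m K N = 0 := by
  unfold cnt
  refine Finset.sum_eq_zero fun X _ => if_neg fun h => ?_
  rcases good_or_und (r := r) h with h | h
  · exact h1 ((good_shift N _).1 h)
  · exact h2 ((und_shift N _).1 h)

lemma cnt_zero_und {r m : ℕ} {N : Fin 6 → ℤ} (h2 : Und r N) :
    cnt r m r N = 0 := by
  unfold cnt
  exact Finset.sum_eq_zero fun X _ => if_neg (not_good_of_und ((und_shift N _).2 h2))

lemma cnt_zero_odd {r m K : ℕ} {N : Fin 6 → ℤ} (hr : 1 ≤ r) (h : ¬ (2 ∣ N 2 ∧ 2 ∣ N 3)) :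
    cnt r m K N = 0 := by
  unfold cnt
  refine Finset.sum_eq_zero fun X _ => if_neg fun hg => h ?_
  have := hg.even
  have h2 : (2 : ℤ) ∣ 2 ^ r := dvd_pow_self 2 (by omega)
  rwa [dvd_add_left (h2.mul_right _), dvd_add_left (h2.mul_right _)] at this

lemma good_two_mul {K : ℕ} (N : Fin 6 → ℤ) : Good K (fun i => 2 * N i) ↔ Good (K - 2) N := by
  have ha : zA (fun i => 2 * N i) = 2 ^ 2 * zA N := by simp only [zA]; ring
  have hb : zB (fun i => 2 * N i) = 2 ^ 2 * zB N := by simp only [zB]; ring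
  have hc : zC (fun i => 2 * N i) = 2 ^ 2 * zC N := by simp only [zC]; ring
  have key : ∀ k (a : ℤ), (2 : ℤ) ^ (k + 2) ∣ 2 ^ 2 * a ↔ 2 ^ k ∣ a := fun k a => by
    rw [add_comm, pow_add]; exact mul_dvd_mul_iff_left (by norm_num)
  unfold Good
  rw [ha, hb, hc]
  constructor
  · rintro ⟨k, hk, h1, h2, h3, h4⟩
    have : 2 ≤ k := by
      by_contra hlt
      exact h2 ((pow_dvd_pow 2 (by omega)).trans (Dvd.intro _ rfl))
    obtain ⟨j, rfl⟩ : ∃ j, k = j + 2 := ⟨k - 2, by omega⟩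
    refine ⟨j, by omega, (key _ _).1 h1, fun h => h2 ?_, (key (j + 1) _).1 ?_, (key (j + 1) _).1 ?_⟩
    · exact (key (j + 1) _).2 h
    · exact h3
    · exact h4
  · rintro ⟨j, hj, h1, h2, h3, h4⟩
    exact ⟨j + 2, by omega, (key _ _).2 h1, fun h => h2 ((key (j + 1) _).1 h),
      (key (j + 1) _).2 h3, (key (j + 1) _).2 h4⟩

lemma cnt_two_mul (r m K : ℕ) (N : Fin 6 → ℤ) :
    cnt (r + 1) m K (fun i => 2 * N i) = cnt r m (K - 2) N := by
  unfold cnt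
  refine Finset.sum_congr rfl fun X _ => ?_
  have : (fun i => 2 * N i + 2 ^ (r + 1) * ((X i : ℕ) : ℤ)) =
      (fun i => 2 * (fun i => N i + 2 ^ r * ((X i : ℕ) : ℤ)) i) := by funext i; ring
  rw [this]
  congr 1
  exact propext (good_two_mul _)

def fz (x : Fin 2) : ZMod 2 := x

def pb (b n0 n1 n4 n5 : ZMod 2) (ε : Fin 6 → Fin 2) : ZMod 2 :=
  b + (n0 * fz (ε 5) + fz (ε 0) * n5 + n1 * fz (ε 4) + fz (ε 1) * n4)
def pa (a n4 n5 : ZMod 2) (ε : Fin 6 → Fin 2) : ZMod 2 := a + (fz (ε 2) * n5 + fz (ε 3) * n4)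
def pc (c n0 n1 : ZMod 2) (ε : Fin 6 → Fin 2) : ZMod 2 := c + (n0 * fz (ε 3) + n1 * fz (ε 2))

set_option synthInstance.maxHeartbeats 400000 in
set_option synthInstance.maxSize 2000 in
lemma parity_count : ∀ a b c n0 n1 n4 n5 : ZMod 2, ¬ (n0 = 0 ∧ n1 = 0 ∧ n4 = 0 ∧ n5 = 0) →
    n0 * n5 = n1 * n4 → n0 * a = n4 * c → n1 * a = n5 * c →
    (Finset.univ.filter fun ε : Fin 6 → Fin 2 =>
      pb b n0 n1 n4 n5 ε = 1 ∧ pa a n4 n5 ε = 0 ∧ pc c n0 n1 ε = 0).card = 16 ∧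
    (Finset.univ.filter fun ε : Fin 6 → Fin 2 =>
      pb b n0 n1 n4 n5 ε = 0 ∧ pa a n4 n5 ε = 0 ∧ pc c n0 n1 ε = 0).card = 16 := by
  decide +kernel

lemma two_dvd_iff (x : ℤ) : 2 ∣ x ↔ (x : ZMod 2) = 0 :=
  ((ZMod.intCast_zmod_eq_zero_iff_dvd x 2)).symm

lemma zmod2_ne (x : ZMod 2) : x ≠ 0 ↔ x = 1 := by revert x; decide

lemma cast_fin2 (x : Fin 2) : (((x : ℕ) : ℤ) : ZMod 2) = fz x := by revert x; decide

lemma pow_succ_dvd (r : ℕ) (x : ℤ) : (2 : ℤ) ^ (r + 1) ∣ 2 ^ r * x ↔ 2 ∣ x := by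
  rw [pow_succ]; exact mul_dvd_mul_iff_left (by positivity)

lemma good_succ {r : ℕ} {N : Fin 6 → ℤ} {a b c : ℤ} (ha : zA N = 2 ^ r * a) (hb : zB N = 2 ^ r * b)
    (hc : zC N = 2 ^ r * c) : Good (r + 1) N ↔ (¬ 2 ∣ b ∧ 2 ∣ a ∧ 2 ∣ c) := by
  constructor
  · rintro ⟨k, hk, h1, h2, h3, h4⟩
    have : k = r := by
      by_contra hne
      apply h2
      rw [hb]
      exact (pow_dvd_pow 2 (by omega)).mul_right _
    subst this
    rw [hb, pow_succ_dvd] at h2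
    rw [ha, pow_succ_dvd] at h3
    rw [hc, pow_succ_dvd] at h4
    exact ⟨h2, h3, h4⟩
  · rintro ⟨h1, h2, h3⟩
    refine ⟨r, by omega, ?_, ?_, ?_, ?_⟩
    · rw [hb]; exact Dvd.intro _ rfl
    · rwa [hb, pow_succ_dvd]
    · rwa [ha, pow_succ_dvd]
    · rwa [hc, pow_succ_dvd]

lemma und_succ {r : ℕ} {N : Fin 6 → ℤ} {a b c : ℤ} (ha : zA N = 2 ^ r * a) (hb : zB N = 2 ^ r * b)
    (hc : zC N = 2 ^ r * c) : Und (r + 1) N ↔ (2 ∣ b ∧ 2 ∣ a ∧ 2 ∣ c) := by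
  unfold Und
  rw [ha, hb, hc, pow_succ_dvd, pow_succ_dvd, pow_succ_dvd]

def AllEven (N : Fin 6 → ℤ) : Prop := 2 ∣ N 0 ∧ 2 ∣ N 1 ∧ 2 ∣ N 4 ∧ 2 ∣ N 5

lemma even_shift {r : ℕ} (x t : ℤ) : (2 : ℤ) ∣ x + 2 ^ (r + 1) * t ↔ 2 ∣ x := by
  have h2 : (2 : ℤ) ∣ 2 ^ (r + 1) := dvd_pow_self 2 (by omega)
  exact dvd_add_left (h2.mul_right _)

lemma cnt_third (m : ℕ) : ∀ (r K : ℕ) (N : Fin 6 → ℤ), r + 1 ≤ K → K ≤ r + 1 + m →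
    Und (r + 1) N → (2 ∣ N 2 ∧ 2 ∣ N 3) → ¬ AllEven N →
    cnt (r + 1) m K N = 64 ^ m * (1 - (1 / 4) ^ (K - (r + 1))) / 3 := by
  induction m with
  | zero =>
    intro r K N h1 h2 hu he hn
    obtain rfl : K = r + 1 := by omega
    rw [cnt_zero_und hu]; simp
  | succ m ih =>
    intro r K N h1 h2 hu he hn
    rcases Nat.eq_or_lt_of_le h1 with h | hlt
    · subst h
      rw [cnt_zero_und hu]; simp
    have hu' := hu
    obtain ⟨⟨b, hb⟩, ⟨a, ha⟩, ⟨c, hc⟩⟩ := hu'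
    have hp : (2 : ℤ) ^ (r + 1) ≠ 0 := by positivity
    have e1 : N 0 * a + N 4 * c = N 2 * b := by
      apply mul_left_cancel₀ hp
      simp only [zA, zB, zC] at ha hb hc
      linear_combination (-N 0) * ha - N 4 * hc + N 2 * hb
    have e2 : N 1 * a + N 5 * c = N 3 * b := by
      apply mul_left_cancel₀ hp
      simp only [zA, zB, zC] at ha hb hc
      linear_combination (-N 1) * ha - N 5 * hc + N 3 * hb
    have n2 := (two_dvd_iff _).1 he.1
    have n3 := (two_dvd_iff _).1 he.2
    have tw : (2 : ZMod 2) = 0 := by decide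
    have e1' := congrArg (Int.cast : ℤ → ZMod 2) e1
    have e2' := congrArg (Int.cast : ℤ → ZMod 2) e2
    have e3' := congrArg (Int.cast : ℤ → ZMod 2) hb
    simp only [zB] at e3'
    push_cast at e1' e2' e3'
    rw [n2, zero_mul] at e1'
    rw [n3, zero_mul] at e2'
    rw [tw, zero_pow (by omega), zero_mul] at e3'
    have neg2 : ∀ x y : ZMod 2, x + y = 0 → x = y := by decide
    have pc0 := parity_count a b c (N 0) (N 1) (N 4) (N 5)
      (fun h => hn ⟨(two_dvd_iff _).2 h.1, (two_dvd_iff _).2 h.2.1, (two_dvd_iff _).2 h.2.2.1,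
        (two_dvd_iff _).2 h.2.2.2⟩) (sub_eq_zero.1 e3') (neg2 _ _ e1') (neg2 _ _ e2')
    rw [cnt_succ]
    set x : ℝ := 64 ^ m with hx
    set y : ℝ := 64 ^ m * (1 - (1 / 4) ^ (K - (r + 1 + 1))) / 3 with hy
    have main : ∀ ε : Fin 6 → Fin 2,
        cnt (r + 1 + 1) m K (fun i => N i + 2 ^ (r + 1) * ((ε i : ℕ) : ℤ)) =
        (if pb b (N 0) (N 1) (N 4) (N 5) ε = 1 ∧ pa a (N 4) (N 5) ε = 0 ∧ pc c (N 0) (N 1) ε = 0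
          then (1 : ℝ) else 0) * x +
        (if pb b (N 0) (N 1) (N 4) (N 5) ε = 0 ∧ pa a (N 4) (N 5) ε = 0 ∧ pc c (N 0) (N 1) ε = 0
          then (1 : ℝ) else 0) * y := by
      intro ε
      set N' : Fin 6 → ℤ := fun i => N i + 2 ^ (r + 1) * ((ε i : ℕ) : ℤ) with hN'
      obtain ⟨b', hb', hbb⟩ : ∃ b' : ℤ, zB N' = 2 ^ (r + 1) * b' ∧
          (b' : ZMod 2) = pb b (N 0) (N 1) (N 4) (N 5) ε := by
        refine ⟨b + (N 0 * (ε 5 : ℕ) + (ε 0 : ℕ) * N 5 - N 1 * (ε 4 : ℕ) - (ε 1 : ℕ) * N 4) +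
          2 ^ (r + 1) * ((ε 0 : ℕ) * (ε 5 : ℕ) - (ε 1 : ℕ) * (ε 4 : ℕ)), ?_, ?_⟩
        · have : zB N' = zB N + 2 ^ (r + 1) * (N 0 * (ε 5 : ℕ) + (ε 0 : ℕ) * N 5
            - N 1 * (ε 4 : ℕ) - (ε 1 : ℕ) * N 4 +
          2 ^ (r + 1) * ((ε 0 : ℕ) * (ε 5 : ℕ) - (ε 1 : ℕ) * (ε 4 : ℕ))) := by
            simp only [zB, hN']; ring
          rw [this, hb]; ring
        · simp only [Int.cast_add, Int.cast_sub, Int.cast_mul, cast_fin2, Int.cast_pow,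
            Int.cast_ofNat, tw, zero_pow (Nat.succ_ne_zero r), zero_mul, add_zero, pb,
            CharTwo.sub_eq_add]
      obtain ⟨a', ha', haa⟩ : ∃ b' : ℤ, zA N' = 2 ^ (r + 1) * b' ∧
          (b' : ZMod 2) = pa a (N 4) (N 5) ε := by
        refine ⟨a + (N 2 * (ε 5 : ℕ) + (ε 2 : ℕ) * N 5 - N 3 * (ε 4 : ℕ) - (ε 3 : ℕ) * N 4) +
          2 ^ (r + 1) * ((ε 2 : ℕ) * (ε 5 : ℕ) - (ε 3 : ℕ) * (ε 4 : ℕ)), ?_, ?_⟩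
        · have : zA N' = zA N + 2 ^ (r + 1) * (N 2 * (ε 5 : ℕ) + (ε 2 : ℕ) * N 5
            - N 3 * (ε 4 : ℕ) - (ε 3 : ℕ) * N 4 +
          2 ^ (r + 1) * ((ε 2 : ℕ) * (ε 5 : ℕ) - (ε 3 : ℕ) * (ε 4 : ℕ))) := by
            simp only [zA, hN']; ring
          rw [this, ha]; ring
        · simp only [Int.cast_add, Int.cast_sub, Int.cast_mul, cast_fin2, Int.cast_pow,
            Int.cast_ofNat, tw, zero_pow (Nat.succ_ne_zero r), zero_mul, add_zero, pa,
            CharTwo.sub_eq_add, n2, n3, zero_add]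
      obtain ⟨c', hc', hcc⟩ : ∃ b' : ℤ, zC N' = 2 ^ (r + 1) * b' ∧
          (b' : ZMod 2) = pc c (N 0) (N 1) ε := by
        refine ⟨c + (N 0 * (ε 3 : ℕ) + (ε 0 : ℕ) * N 3 - N 1 * (ε 2 : ℕ) - (ε 1 : ℕ) * N 2) +
          2 ^ (r + 1) * ((ε 0 : ℕ) * (ε 3 : ℕ) - (ε 1 : ℕ) * (ε 2 : ℕ)), ?_, ?_⟩
        · have : zC N' = zC N + 2 ^ (r + 1) * (N 0 * (ε 3 : ℕ) + (ε 0 : ℕ) * N 3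
            - N 1 * (ε 2 : ℕ) - (ε 1 : ℕ) * N 2 +
          2 ^ (r + 1) * ((ε 0 : ℕ) * (ε 3 : ℕ) - (ε 1 : ℕ) * (ε 2 : ℕ))) := by
            simp only [zC, hN']; ring
          rw [this, hc]; ring
        · simp only [Int.cast_add, Int.cast_sub, Int.cast_mul, cast_fin2, Int.cast_pow,
            Int.cast_ofNat, tw, zero_pow (Nat.succ_ne_zero r), zero_mul, mul_zero, add_zero, pc,
            CharTwo.sub_eq_add, n2, n3]
      have hg := good_succ ha' hb' hc'
      have hu2 := und_succ ha' hb' hc'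
      rw [two_dvd_iff, two_dvd_iff, two_dvd_iff, hbb, haa, hcc] at hg hu2
      rw [← ne_eq, zmod2_ne] at hg
      by_cases hgg : Good (r + 1 + 1) N'
      · rw [if_pos (hg.1 hgg), if_neg (fun h => not_good_of_und (hu2.2 h) hgg), cnt_full hlt hgg]; ring
      · by_cases huu : Und (r + 1 + 1) N'
        · rw [if_neg (fun h => hgg (hg.2 h)), if_pos (hu2.1 huu), ih (r + 1) K N' hlt (by omega) huu]
          · ring
          · simpa only [hN', even_shift] using he
          · simpa only [AllEven, hN', even_shift] using hn
        · rw [if_neg (fun h => hgg (hg.2 h)), if_neg (fun h => huu (hu2.2 h)), cnt_zero hgg huu]; ring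
    rw [Finset.sum_congr rfl fun ε _ => main ε, Finset.sum_add_distrib, ← Finset.sum_mul,
      ← Finset.sum_mul, Finset.sum_boole, Finset.sum_boole, pc0.1, pc0.2, hy, hx]
    obtain ⟨j, rfl⟩ : ∃ j, K = r + 1 + 1 + j := ⟨K - (r + 1 + 1), by omega⟩
    rw [show r + 1 + 1 + j - (r + 1 + 1) = j by omega,
      show r + 1 + 1 + j - (r + 1) = j + 1 by omega]
    push_cast
    ring

/-- density value times 21 -/
lemma good_one (N : Fin 6 → ℤ) : Good 1 N ↔ (¬ 2 ∣ zB N ∧ 2 ∣ zA N ∧ 2 ∣ zC N) := by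
  apply good_succ (r := 0) <;> simp
lemma und_one (N : Fin 6 → ℤ) : Und 1 N ↔ (2 ∣ zB N ∧ 2 ∣ zA N ∧ 2 ∣ zC N) := by
  apply und_succ (r := 0) <;> simp

def qA (N : Fin 6 → ZMod 2) : ZMod 2 := N 2 * N 5 - N 3 * N 4
def qB (N : Fin 6 → ZMod 2) : ZMod 2 := N 0 * N 5 - N 1 * N 4
def qC (N : Fin 6 → ZMod 2) : ZMod 2 := N 0 * N 3 - N 1 * N 2

def c1 (N : Fin 6 → ZMod 2) : Prop :=
  N 2 = 0 ∧ N 3 = 0 ∧ ¬ (N 0 = 0 ∧ N 1 = 0 ∧ N 4 = 0 ∧ N 5 = 0) ∧ qB N = 1 ∧ qA N = 0 ∧ qC N = 0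
def c2 (N : Fin 6 → ZMod 2) : Prop :=
  N 2 = 0 ∧ N 3 = 0 ∧ ¬ (N 0 = 0 ∧ N 1 = 0 ∧ N 4 = 0 ∧ N 5 = 0) ∧ qB N = 0 ∧ qA N = 0 ∧ qC N = 0
def c3 (N : Fin 6 → ZMod 2) : Prop :=
  N 2 = 0 ∧ N 3 = 0 ∧ (N 0 = 0 ∧ N 1 = 0 ∧ N 4 = 0 ∧ N 5 = 0)
instance : DecidablePred c1 := fun N => by unfold c1; infer_instance
instance : DecidablePred c2 := fun N => by unfold c2; infer_instance
instance : DecidablePred c3 := fun N => by unfold c3; infer_instance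

lemma count_one : (Finset.univ.filter c1).card = 6 ∧ (Finset.univ.filter c2).card = 9 ∧
    (Finset.univ.filter c3).card = 1 := by
  decide +kernel

lemma cnt_base (m : ℕ) : ∀ (K : ℕ) (N : Fin 6 → ℤ), K ≤ m →
    cnt 0 m K N = 64 ^ m * (1 / 7 - (1 / 4) ^ K / 4 + 3 / 28 * (1 / 8) ^ K) := by
  induction m with
  | zero =>
    intro K N hK
    obtain rfl : K = 0 := by omega
    rw [cnt_zero_und (by simp [Und])]
    norm_num
  | succ m ih =>
    intro K N hK
    rcases Nat.eq_zero_or_pos K with h | hlt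
    · subst h
      rw [cnt_zero_und (by simp [Und])]
      norm_num
    rw [cnt_succ]
    set x : ℝ := 64 ^ m with hx
    set y : ℝ := 64 ^ m * (1 - (1 / 4) ^ (K - 1)) / 3 with hy
    set z : ℝ := 64 ^ m * (1 / 7 - (1 / 4) ^ (K - 2) / 4 + 3 / 28 * (1 / 8) ^ (K - 2)) with hz
    let red : (Fin 6 → Fin 2) → (Fin 6 → ZMod 2) := fun ε i => (N i : ZMod 2) + fz (ε i)
    have hbij : Function.Bijective red := by
      have : Function.Injective red := by
        intro ε ε' h
        funext i
        exact add_left_cancel (a := (N i : ZMod 2)) (congrFun h i)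
      exact (Fintype.bijective_iff_injective_and_card _).2 ⟨this, rfl⟩
    have main : ∀ ε : Fin 6 → Fin 2,
        cnt (0 + 1) m K (fun i => N i + 2 ^ 0 * ((ε i : ℕ) : ℤ)) =
        (if c1 (red ε) then (1 : ℝ) else 0) * x + (if c2 (red ε) then (1 : ℝ) else 0) * y
         + (if c3 (red ε) then (1 : ℝ) else 0) * z := by
      intro ε
      set N' : Fin 6 → ℤ := fun i => N i + 2 ^ 0 * ((ε i : ℕ) : ℤ) with hN'
      have hred : ∀ i, (N' i : ZMod 2) = red ε i := fun i => by
        simp only [hN', pow_zero, one_mul, Int.cast_add, cast_fin2, red]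
      have hqa : (zA N' : ZMod 2) = qA (red ε) := by simp [zA, qA, hred]
      have hqb : (zB N' : ZMod 2) = qB (red ε) := by simp [zB, qB, hred]
      have hqc : (zC N' : ZMod 2) = qC (red ε) := by simp [zC, qC, hred]
      have hg := good_one N'
      have hu := und_one N'
      rw [two_dvd_iff, two_dvd_iff, two_dvd_iff, hqa, hqb, hqc] at hg hu
      rw [← ne_eq, zmod2_ne] at hg
      have he : (2 ∣ N' 2 ∧ 2 ∣ N' 3) ↔ (red ε 2 = 0 ∧ red ε 3 = 0) := by
        simp only [two_dvd_iff, hred]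
      have hE : AllEven N' ↔ (red ε 0 = 0 ∧ red ε 1 = 0 ∧ red ε 4 = 0 ∧ red ε 5 = 0) := by
        simp only [AllEven, two_dvd_iff, hred]
      have k1 : c1 (red ε) ↔ ((2 ∣ N' 2 ∧ 2 ∣ N' 3) ∧ ¬ AllEven N' ∧ Good 1 N') := by
        unfold c1; rw [hE, hg, he, and_assoc]
      have k2 : c2 (red ε) ↔ ((2 ∣ N' 2 ∧ 2 ∣ N' 3) ∧ ¬ AllEven N' ∧ Und 1 N') := by
        unfold c2; rw [hE, hu, he, and_assoc]
      have k3 : c3 (red ε) ↔ ((2 ∣ N' 2 ∧ 2 ∣ N' 3) ∧ AllEven N') := by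
        unfold c3; rw [hE, he, and_assoc]
      classical
      rw [if_congr k1 rfl rfl, if_congr k2 rfl rfl, if_congr k3 rfl rfl]
      by_cases h1 : 2 ∣ N' 2 ∧ 2 ∣ N' 3
      · by_cases h2 : AllEven N'
        · have : ∃ Q : Fin 6 → ℤ, N' = fun i => 2 * Q i := by
            have : ∀ i, ∃ q, N' i = 2 * q := by
              obtain ⟨h3, h4⟩ := h1
              obtain ⟨h5, h6, h7, h8⟩ := h2
              intro i
              fin_cases i <;> assumption
            choose Q hQ using this
            exact ⟨Q, funext hQ⟩
          obtain ⟨Q, hQ⟩ := this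
          have hv : cnt (0 + 1) m K N' = z := by
            rw [hQ, cnt_two_mul, ih (K - 2) Q (by omega)]
          simp [h1, h2, hv]
        · by_cases h3 : Good 1 N'
          · have h4 : ¬ Und 1 N' := fun h => not_good_of_und h h3
            simp [h1, h2, h3, h4, cnt_full hlt h3, hx]
          · by_cases h4 : Und 1 N'
            · have := cnt_third m 0 K N' hlt (by omega) h4 h1 h2
              simp only [zero_add] at this
              simp [h1, h2, h3, h4, this, hy]
            · simp [h1, h2, h3, h4, cnt_zero h3 h4]
      · rw [cnt_zero_odd (by omega) h1]
        simp [h1]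
    rw [Finset.sum_congr rfl fun ε _ => main ε,
      hbij.sum_comp (fun N => (if c1 N then (1 : ℝ) else 0) * x + (if c2 N then (1 : ℝ) else 0) * y
         + (if c3 N then (1 : ℝ) else 0) * z), Finset.sum_add_distrib, Finset.sum_add_distrib,
      ← Finset.sum_mul, ← Finset.sum_mul, ← Finset.sum_mul, Finset.sum_boole, Finset.sum_boole,
      Finset.sum_boole, count_one.1, count_one.2.1, count_one.2.2, hx, hy, hz]
    rcases Nat.lt_or_ge K 2 with h | h
    · obtain rfl : K = 1 := by omega
      norm_num; ring
    · obtain ⟨j, rfl⟩ : ∃ j, K = j + 2 := ⟨K - 2, by omega⟩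
      rw [show j + 2 - 2 = j by omega, show j + 2 - 1 = j + 1 by omega]
      push_cast
      ring

def Lim (r : ℕ) (N : Fin 6 → ℤ) (d : ℝ) : Prop :=
  ∀ s : ℕ, Tendsto (fun m : ℕ => cnt r m (r + m - s) N / 64 ^ m) atTop (nhds d)

lemma lim_of_eventually {r : ℕ} {N : Fin 6 → ℤ} {d : ℝ} (g : ℕ → ℕ → ℝ)
    (hg : ∀ s, Tendsto (g s) atTop (nhds d))
    (h : ∀ s m, s ≤ m → cnt r m (r + m - s) N = 64 ^ m * g s m) : Lim r N d := by
  intro s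
  refine (hg s).congr' ?_
  filter_upwards [eventually_ge_atTop s] with m hm
  rw [h s m hm]; field_simp

lemma lim_full {r : ℕ} {N : Fin 6 → ℤ} (h : Good r N) : Lim r N 1 :=
  lim_of_eventually (fun _ _ => 1) (fun _ => tendsto_const_nhds) fun s m hm => by
    rw [cnt_full (by omega) h, mul_one]

lemma lim_zero {r : ℕ} {N : Fin 6 → ℤ} (h1 : ¬ Good r N) (h2 : ¬ Und r N) : Lim r N 0 :=
  lim_of_eventually (fun _ _ => 0) (fun _ => tendsto_const_nhds) fun s m hm => by
    rw [cnt_zero h1 h2, mul_zero]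

lemma lim_zero_odd {r : ℕ} {N : Fin 6 → ℤ} (hr : 1 ≤ r) (h : ¬ (2 ∣ N 2 ∧ 2 ∣ N 3)) : Lim r N 0 :=
  lim_of_eventually (fun _ _ => 0) (fun _ => tendsto_const_nhds) fun s m hm => by
    rw [cnt_zero_odd hr h, mul_zero]

lemma tendsto_pow_sub {q : ℝ} (h0 : 0 ≤ q) (h1 : q < 1) (s : ℕ) :
    Tendsto (fun m : ℕ => q ^ (m - s)) atTop (nhds 0) :=
  (tendsto_pow_atTop_nhds_zero_of_lt_one h0 h1).comp (tendsto_sub_atTop_nat s)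

lemma lim_third {r : ℕ} {N : Fin 6 → ℤ} (hu : Und (r + 1) N) (he : 2 ∣ N 2 ∧ 2 ∣ N 3)
    (hn : ¬ AllEven N) : Lim (r + 1) N (1 / 3) := by
  refine lim_of_eventually (fun s m => (1 - (1 / 4) ^ (m - s)) / 3) (fun s => ?_) fun s m hm => ?_
  · have := ((tendsto_pow_sub (q := 1 / 4) (by norm_num) (by norm_num) s).const_sub 1).div_const 3
    simpa using this
  · rw [cnt_third m r _ N (by omega) (by omega) hu he hn,
      show r + 1 + m - s - (r + 1) = m - s by omega]
    ring

lemma lim_base (N : Fin 6 → ℤ) : Lim 0 N (1 / 7) := by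
  refine lim_of_eventually
    (fun s m => 1 / 7 - (1 / 4) ^ (m - s) / 4 + 3 / 28 * (1 / 8) ^ (m - s)) (fun s => ?_)
    fun s m hm => ?_
  · have h1 := ((tendsto_pow_sub (q := 1 / 4) (by norm_num) (by norm_num) s).div_const 4).const_sub
      (1 / 7)
    have h2 := (tendsto_pow_sub (q := 1 / 8) (by norm_num) (by norm_num) s).const_mul (3 / 28)
    simpa using h1.add h2
  · rw [cnt_base m _ N (by omega), show 0 + m - s = m - s by omega]

lemma lim_two_mul {r : ℕ} {N : Fin 6 → ℤ} {d : ℝ} (h : Lim r N d) :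
    Lim (r + 1) (fun i => 2 * N i) d := by
  intro s
  refine (h (s + 1)).congr fun m => ?_
  rw [cnt_two_mul, show r + 1 + m - s - 2 = r + m - (s + 1) by omega]

instance (r : ℕ) (N : Fin 6 → ℤ) : Decidable (Good r N) :=
  decidable_of_iff (∃ k : Fin r, (2 : ℤ) ^ (k : ℕ) ∣ zB N ∧ ¬ (2 : ℤ) ^ ((k : ℕ) + 1) ∣ zB N ∧
    (2 : ℤ) ^ ((k : ℕ) + 1) ∣ zA N ∧ (2 : ℤ) ^ ((k : ℕ) + 1) ∣ zC N)
    ⟨fun ⟨k, h⟩ => ⟨k, k.2, h⟩, fun ⟨k, hk, h⟩ => ⟨⟨k, hk⟩, h⟩⟩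
instance (r : ℕ) (N : Fin 6 → ℤ) : Decidable (Und r N) := by unfold Und; infer_instance

/-- 21 times the limiting density -/
def wt : ℕ → ℤ → ℤ → ℤ → ℤ → ℤ → ℤ → ℕ
  | 0, _, _, _, _, _, _ => 3
  | r + 1, a, b, c, d, e, f =>
    if c % 2 = 0 ∧ d % 2 = 0 then
      if a % 2 = 0 ∧ b % 2 = 0 ∧ e % 2 = 0 ∧ f % 2 = 0 then
        wt r (a / 2) (b / 2) (c / 2) (d / 2) (e / 2) (f / 2)
      else if Good (r + 1) ![a, b, c, d, e, f] then 21
      else if Und (r + 1) ![a, b, c, d, e, f] then 7 else 0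
    else 0

lemma lim_wt (r : ℕ) : ∀ a b c d e f : ℤ,
    Lim r ![a, b, c, d, e, f] ((wt r a b c d e f : ℕ) / 21 : ℝ) := by
  induction r with
  | zero =>
    intro a b c d e f
    simp only [wt]
    convert lim_base _ using 1; norm_num
  | succ r ih =>
    intro a b c d e f
    simp only [wt]
    split_ifs with h1 h2 h3 h4
    · have := lim_two_mul (ih (a / 2) (b / 2) (c / 2) (d / 2) (e / 2) (f / 2))
      convert this using 1
      funext i
      fin_cases i <;> simp <;> omega
    · convert lim_full h3 using 1; norm_num
    · convert lim_third h4 ?_ ?_ using 1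
      · norm_num
      · exact ⟨Int.dvd_of_emod_eq_zero h1.1, Int.dvd_of_emod_eq_zero h1.2⟩
      · rintro ⟨g1, g2, g3, g4⟩
        exact h2 ⟨Int.emod_eq_zero_of_dvd g1, Int.emod_eq_zero_of_dvd g2,
          Int.emod_eq_zero_of_dvd g3, Int.emod_eq_zero_of_dvd g4⟩
    · convert lim_zero h3 h4 using 1; norm_num
    · convert lim_zero_odd (r := r + 1) (by omega) ?_ using 1
      · norm_num
      · rintro ⟨g1, g2⟩
        exact h1 ⟨Int.emod_eq_zero_of_dvd g1, Int.emod_eq_zero_of_dvd g2⟩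

lemma zdvd {K j : ℕ} (h : j ≤ K) (x : ℤ) :
    (2 : ZMod (2 ^ K)) ^ j ∣ (x : ZMod (2 ^ K)) ↔ (2 : ℤ) ^ j ∣ x := by
  constructor
  · rintro ⟨c, hc⟩
    obtain ⟨y, rfl⟩ := ZMod.intCast_surjective c
    have : ((x - 2 ^ j * y : ℤ) : ZMod (2 ^ K)) = 0 := by push_cast; rw [hc]; ring
    rw [ZMod.intCast_zmod_eq_zero_iff_dvd] at this
    push_cast at this
    have h2 := (pow_dvd_pow (2 : ℤ) h).trans this
    have := dvd_add h2 (Dvd.intro y rfl : (2 : ℤ) ^ j ∣ 2 ^ j * y)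
    simpa using this
  · rintro ⟨c, rfl⟩
    exact ⟨c, by push_cast; ring⟩

lemma le_ord2 {K j : ℕ} (h : j ≤ K) (t : ZMod (2 ^ K)) :
    j ≤ ord2 K t ↔ (2 : ZMod (2 ^ K)) ^ j ∣ t := by
  have hb : BddAbove {j : ℕ | j ≤ K ∧ (2 : ZMod (2 ^ K)) ^ j ∣ t} := ⟨K, fun x hx => hx.1⟩
  constructor
  · intro hj
    have := Nat.sSup_mem (s := {j : ℕ | j ≤ K ∧ (2 : ZMod (2 ^ K)) ^ j ∣ t}) ⟨0, by simp⟩ hb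
    exact (pow_dvd_pow _ hj).trans this.2
  · intro hj
    exact le_csSup hb ⟨h, hj⟩

lemma ord2_le (K : ℕ) (t : ZMod (2 ^ K)) : ord2 K t ≤ K :=
  csSup_le ⟨0, by simp⟩ fun x hx => hx.1

lemma good_iff_ord (K : ℕ) (N : Fin 6 → ℤ) : Good K N ↔
    ord2 K (zB N : ZMod (2 ^ K)) < ord2 K (zA N : ZMod (2 ^ K)) ∧
    ord2 K (zB N : ZMod (2 ^ K)) < ord2 K (zC N : ZMod (2 ^ K)) := by
  constructor
  · rintro ⟨k, hk, h1, h2, h3, h4⟩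
    rw [← zdvd (K := K) (by omega), ← le_ord2 (by omega)] at h1 h2 h3 h4
    omega
  · rintro ⟨h1, h2⟩
    have hK := ord2_le K (zA N : ZMod (2 ^ K))
    refine ⟨ord2 K (zB N : ZMod (2 ^ K)), by omega, ?_⟩
    rw [← zdvd (K := K) (by omega), ← le_ord2 (by omega), ← zdvd (K := K) (by omega),
      ← le_ord2 (by omega), ← zdvd (K := K) (by omega), ← le_ord2 (by omega),
      ← zdvd (K := K) (by omega), ← le_ord2 (by omega)]
    omega

def tup (M : Matrix (Fin 3) (Fin 3) (ZMod (2 ^ 3))) : Fin 6 → ℤ :=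
  ![(M 0 0).val, (M 0 1).val, (M 1 0).val, (M 1 1).val, (M 2 0).val, (M 2 1).val]

def matOf {n : ℕ} (x : Fin 6 → ZMod n) : Matrix (Fin 3) (Fin 3) (ZMod n) :=
  !![x 0, x 1, 0; x 2, x 3, 0; x 4, x 5, 0]

lemma lift_val (m : ℕ) (z : ZMod (2 ^ 3)) (x : Fin (2 ^ m)) :
    (((z.val : ℤ) + 2 ^ 3 * ((x : ℕ) : ℤ) : ℤ) : ZMod (2 ^ (3 + m))).val = z.val + 8 * x := by
  have : ((z.val : ℤ) + 2 ^ 3 * ((x : ℕ) : ℤ) : ℤ) = ((z.val + 8 * (x : ℕ) : ℕ) : ℤ) := by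
    push_cast; ring
  rw [this, Int.cast_natCast, ZMod.val_natCast, Nat.mod_eq_of_lt]
  have h1 := ZMod.val_lt z
  have h2 := x.2
  rw [pow_add]; omega

lemma lift_exists (m : ℕ) (y : ZMod (2 ^ (3 + m))) (z : ZMod (2 ^ 3))
    (h : ((y.val : ℕ) : ZMod (2 ^ 3)) = z) : ∃ x : Fin (2 ^ m),
    (((z.val : ℤ) + 2 ^ 3 * ((x : ℕ) : ℤ) : ℤ) : ZMod (2 ^ (3 + m))) = y := by
  have h1 := ZMod.val_lt y
  have h1' : y.val < 8 * 2 ^ m := lt_of_lt_of_eq h1 (pow_add 2 3 m)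
  refine ⟨⟨y.val / 8, by omega⟩, ?_⟩
  apply ZMod.val_injective
  rw [lift_val, ← h, ZMod.val_natCast]
  simp only
  omega

lemma lift_red (m : ℕ) (z : ZMod (2 ^ 3)) (x : Fin (2 ^ m)) :
    (((((z.val : ℤ) + 2 ^ 3 * ((x : ℕ) : ℤ) : ℤ) : ZMod (2 ^ (3 + m))).val : ℕ) : ZMod (2 ^ 3))
      = z := by
  rw [lift_val]
  push_cast
  rw [show (8 : ZMod (2 ^ 3)) = 0 from rfl, zero_mul, add_zero, ZMod.natCast_zmod_val]

lemma cnt_eq_card (r m K : ℕ) (N : Fin 6 → ℤ) : cnt r m K N =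
    (Nat.card {X : Fin 6 → Fin (2 ^ m) // Good K (fun i => N i + 2 ^ r * ((X i : ℕ) : ℤ))} : ℝ) := by
  classical
  unfold cnt
  rw [Nat.card_eq_fintype_card, Fintype.card_subtype, Finset.card_filter]
  push_cast
  congr!

lemma eta_eq (m : ℕ) (M₀ : Matrix (Fin 3) (Fin 3) (ZMod (2 ^ 3))) (h0 : ∀ i, M₀ i 2 = 0) :
    (eta 3 (3 + m) M₀ : ℝ) = cnt 3 m (3 + m) (tup M₀) := by
  rw [cnt_eq_card]
  unfold eta
  congr 1
  symm
  let lf : (Fin 6 → Fin (2 ^ m)) → Fin 6 → ℤ := fun X i => tup M₀ i + 2 ^ 3 * ((X i : ℕ) : ℤ)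
  have hgood : ∀ X, Good (3 + m) (lf X) ↔
      ord2 (3 + m) (Bf (matOf fun i => (lf X i : ZMod (2 ^ (3 + m))))) <
      ord2 (3 + m) (Af (matOf fun i => (lf X i : ZMod (2 ^ (3 + m))))) ∧
      ord2 (3 + m) (Bf (matOf fun i => (lf X i : ZMod (2 ^ (3 + m))))) <
      ord2 (3 + m) (Cf (matOf fun i => (lf X i : ZMod (2 ^ (3 + m))))) := by
    intro X
    rw [good_iff_ord]
    have hA : ((zA (lf X) : ℤ) : ZMod (2 ^ (3 + m))) =
      Af (matOf fun i => (lf X i : ZMod (2 ^ (3 + m)))) := by simp [zA, Af, matOf]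
    have hB : ((zB (lf X) : ℤ) : ZMod (2 ^ (3 + m))) =
      Bf (matOf fun i => (lf X i : ZMod (2 ^ (3 + m)))) := by simp [zB, Bf, matOf]
    have hC : ((zC (lf X) : ℤ) : ZMod (2 ^ (3 + m))) =
      Cf (matOf fun i => (lf X i : ZMod (2 ^ (3 + m)))) := by simp [zC, Cf, matOf]
    rw [hA, hB, hC]
  refine Nat.card_eq_of_bijective
    (fun X => ⟨matOf fun i => (lf X.1 i : ZMod (2 ^ (3 + m))), ?_, ?_, (hgood X.1).1 X.2⟩) ⟨?_, ?_⟩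
  · intro i; fin_cases i <;> rfl
  · have zz : ∀ x : ZMod (2 ^ 3), x = 0 →
        (((0 : ZMod (2 ^ (3 + m))).val : ℕ) : ZMod (2 ^ 3)) = x := by
      rintro x rfl
      rw [ZMod.val_zero, Nat.cast_zero]
    intro i j
    fin_cases i <;> fin_cases j
    · exact lift_red m (M₀ 0 0) _
    · exact lift_red m (M₀ 0 1) _
    · exact zz _ (h0 0)
    · exact lift_red m (M₀ 1 0) _
    · exact lift_red m (M₀ 1 1) _
    · exact zz _ (h0 1)
    · exact lift_red m (M₀ 2 0) _
    · exact lift_red m (M₀ 2 1) _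
    · exact zz _ (h0 2)
  · rintro ⟨X, hX⟩ ⟨Y, hY⟩ h
    have h' : (matOf fun i => (lf X i : ZMod (2 ^ (3 + m)))) =
      (matOf fun i => (lf Y i : ZMod (2 ^ (3 + m)))) := congrArg Subtype.val h
    have key : ∀ (z : ZMod (2 ^ 3)) (x y : Fin (2 ^ m)),
      (((z.val : ℤ) + 2 ^ 3 * ((x : ℕ) : ℤ) : ℤ) : ZMod (2 ^ (3 + m))) =
      (((z.val : ℤ) + 2 ^ 3 * ((y : ℕ) : ℤ) : ℤ) : ZMod (2 ^ (3 + m))) → x = y := by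
      intro z x y h
      have := congrArg ZMod.val h
      rw [lift_val, lift_val] at this
      exact Fin.ext (by omega)
    have : X = Y := by
      funext i
      fin_cases i
      · exact key (M₀ 0 0) _ _ (congrFun (congrFun h' 0) 0)
      · exact key (M₀ 0 1) _ _ (congrFun (congrFun h' 0) 1)
      · exact key (M₀ 1 0) _ _ (congrFun (congrFun h' 1) 0)
      · exact key (M₀ 1 1) _ _ (congrFun (congrFun h' 1) 1)
      · exact key (M₀ 2 0) _ _ (congrFun (congrFun h' 2) 0)
      · exact key (M₀ 2 1) _ _ (congrFun (congrFun h' 2) 1)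
    subst this; rfl
  · rintro ⟨M, hM0, hM1, hM2⟩
    obtain ⟨x0, e0⟩ := lift_exists m _ _ (hM1 0 0)
    obtain ⟨x1, e1⟩ := lift_exists m _ _ (hM1 0 1)
    obtain ⟨x2, e2⟩ := lift_exists m _ _ (hM1 1 0)
    obtain ⟨x3, e3⟩ := lift_exists m _ _ (hM1 1 1)
    obtain ⟨x4, e4⟩ := lift_exists m _ _ (hM1 2 0)
    obtain ⟨x5, e5⟩ := lift_exists m _ _ (hM1 2 1)
    have hM : (matOf fun i => (lf ![x0, x1, x2, x3, x4, x5] i : ZMod (2 ^ (3 + m)))) = M := by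
      ext i j
      fin_cases i <;> fin_cases j
      · exact e0
      · exact e1
      · exact (hM0 0).symm
      · exact e2
      · exact e3
      · exact (hM0 1).symm
      · exact e4
      · exact e5
      · exact (hM0 2).symm
    exact ⟨⟨![x0, x1, x2, x3, x4, x5], (hgood _).2 (by rw [hM]; exact hM2)⟩, Subtype.ext hM⟩

def wM (M : Matrix (Fin 3) (Fin 3) (ZMod (2 ^ 3))) : ℕ :=
  wt 3 (M 0 0).val (M 0 1).val (M 1 0).val (M 1 1).val (M 2 0).val (M 2 1).val

lemma eta_tendsto (M₀ : Matrix (Fin 3) (Fin 3) (ZMod (2 ^ 3))) (h0 : ∀ i, M₀ i 2 = 0) :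
    Tendsto (fun K : ℕ => (eta 3 K M₀ : ℝ) / 64 ^ (K - 3)) atTop (nhds ((wM M₀ : ℕ) / 21 : ℝ)) := by
  rw [← tendsto_add_atTop_iff_nat 3]
  have := lim_wt 3 (M₀ 0 0).val (M₀ 0 1).val (M₀ 1 0).val (M₀ 1 1).val (M₀ 2 0).val (M₀ 2 1).val 0
  refine this.congr fun m => ?_
  rw [add_comm m 3, eta_eq m M₀ h0, Nat.add_sub_cancel_left, Nat.sub_zero]
  rfl

abbrev Z8 := ZMod (2 ^ 3)

def Hp (a b c d : Z8) : Prop :=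
  a.val % 2 = 1 ∧ d.val % 2 = 1 ∧ c.val % 2 = 0 ∧ (c.val % 4 = 0 ↔ (a * d - b * c = 1 ∨ a * d - b * c = 3))
instance (a b c d : Z8) : Decidable (Hp a b c d) := by unfold Hp; infer_instance

def HpM (M : Matrix (Fin 2) (Fin 2) Z8) : Prop := Hp (M 0 0) (M 0 1) (M 1 0) (M 1 1)

lemma Hp_steps : ∀ a b c d : Z8, Hp a b c d →
    Hp a (a + b) c (c + d) ∧ Hp a (a * 7 + b) c (c * 7 + d) ∧
    Hp (a * 7 + b * 2) b (c * 7 + d * 2) d ∧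
    Hp (a * 5 + b * 2) b (c * 5 + d * 2) d ∧ Hp (a * 5 + b * 6) b (c * 5 + d * 6) d := by
  decide +kernel

lemma H_sub (h : GL (Fin 2) Z8) (hh : h ∈ H) : HpM h.val := by
  unfold H at hh
  induction hh using Subgroup.closure_induction_right with
  | one => unfold HpM; decide
  | mul_right x hx y hy ih =>
    have := Hp_steps _ _ _ _ ih
    rcases hy with rfl | rfl | rfl
    · simpa [HpM, u1, Matrix.mul_apply, Fin.sum_univ_two] using this.1
    · simpa [HpM, u2, Matrix.mul_apply, Fin.sum_univ_two] using this.2.2.1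
    · simpa [HpM, u3, Matrix.mul_apply, Fin.sum_univ_two] using this.2.2.2.1
  | mul_inv_cancel x hx y hy ih =>
    have := Hp_steps _ _ _ _ ih
    rcases hy with rfl | rfl | rfl
    · have e : (u1⁻¹ : GL (Fin 2) Z8).val = !![1,7;0,1] := rfl
      rw [Units.val_mul, e]
      simpa [HpM, Matrix.mul_apply, Fin.sum_univ_two] using this.2.1
    · have e : (u2⁻¹ : GL (Fin 2) Z8).val = !![7,0;2,1] := rfl
      rw [Units.val_mul, e]
      simpa [HpM, Matrix.mul_apply, Fin.sum_univ_two] using this.2.2.1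
    · have e : (u3⁻¹ : GL (Fin 2) Z8).val = !![5,0;6,1] := rfl
      rw [Units.val_mul, e]
      simpa [HpM, Matrix.mul_apply, Fin.sum_univ_two] using this.2.2.2.2

def v3 : GL (Fin 2) Z8 := u2 * u1 * u3 * u1
def v5 : GL (Fin 2) Z8 := u1 * u2 * u3 * u1 * u2

lemma low_words : ∀ a c d : Z8, Hp a 0 c d → ∃ j : Fin 2, ∃ k : Fin 4, ∃ l n : Fin 2,
    (u2 ^ (j : ℕ) * u3 ^ (k : ℕ) * v3 ^ (l : ℕ) * v5 ^ (n : ℕ)).val = !![a, 0; c, d] := by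
  decide +kernel

lemma u1_pow : ∀ i : Z8, (u1 ^ i.val).val = !![1, i; 0, 1] := by decide +kernel

lemma Hp_low : ∀ a b c d : Z8, Hp a b c d → Hp (a - b * d * c) 0 c d ∧ b * d * d = b := by
  decide +kernel

lemma H_sup (a b c d : Z8) (h : Hp a b c d) : ∃ h ∈ H, h.val = !![a, b; c, d] := by
  have m1 : u1 ∈ H := Subgroup.subset_closure (by simp)
  have m2 : u2 ∈ H := Subgroup.subset_closure (by simp)
  have m3 : u3 ∈ H := Subgroup.subset_closure (by simp)
  have n3 : v3 ∈ H := mul_mem (mul_mem (mul_mem m2 m1) m3) m1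
  have n5 : v5 ∈ H := mul_mem (mul_mem (mul_mem (mul_mem m1 m2) m3) m1) m2
  obtain ⟨hl, hb⟩ := Hp_low a b c d h
  obtain ⟨j, k, l, n, hw⟩ := low_words _ _ _ hl
  refine ⟨u1 ^ (b * d).val * (u2 ^ (j : ℕ) * u3 ^ (k : ℕ) * v3 ^ (l : ℕ) * v5 ^ (n : ℕ)),
    mul_mem (pow_mem m1 _) (mul_mem (mul_mem (mul_mem (pow_mem m2 _) (pow_mem m3 _))
      (pow_mem n3 _)) (pow_mem n5 _)), ?_⟩
  rw [Units.val_mul, u1_pow, hw]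
  simp [hb]

def Ec (a b c d e : Z8) : Prop := e.val % 2 = 0 ↔ (a * d - b * c = 1 ∨ a * d - b * c = 7)
instance (a b c d e : Z8) : Decidable (Ec a b c d e) := by unfold Ec; infer_instance

lemma two_dvd8 : ∀ e : Z8, 2 ∣ e ↔ e.val % 2 = 0 := by decide +kernel

def mk3 (a b c d e f : Z8) : Matrix (Fin 3) (Fin 3) Z8 := !![a, b, 0; c, d, 0; e, f, 1]

lemma mem_I3 (g : Matrix (Fin 3) (Fin 3) Z8) : g ∈ I3 ↔
    (g 0 2 = 0 ∧ g 1 2 = 0 ∧ g 2 2 = 1) ∧ Hp (g 0 0) (g 0 1) (g 1 0) (g 1 1) ∧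
      Ec (g 0 0) (g 0 1) (g 1 0) (g 1 1) (g 2 0) := by
  classical
  unfold I3
  rw [Finset.mem_filter]
  have h1 : (∃ h ∈ H, ∀ i j : Fin 2,
      (h : Matrix (Fin 2) (Fin 2) (ZMod (2 ^ 3))) i j = g i.castSucc j.castSucc) ↔
      Hp (g 0 0) (g 0 1) (g 1 0) (g 1 1) := by
    constructor
    · rintro ⟨h, hh, he⟩
      have := H_sub h hh
      unfold HpM at this
      rwa [he, he, he, he] at this
    · intro h
      obtain ⟨x, hx, he⟩ := H_sup _ _ _ _ h
      refine ⟨x, hx, fun i j => ?_⟩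
      rw [he]
      fin_cases i <;> fin_cases j <;> rfl
  rw [h1, two_dvd8]
  simp only [Finset.mem_univ, true_and, Set.mem_insert_iff, Set.mem_singleton_iff, Ec]
  tauto

set_option linter.constructorNameAsVariable false

lemma sum_I3 (F : Matrix (Fin 3) (Fin 3) Z8 → ℕ) : ∑ M ∈ I3, F M =
    ∑ a : Z8, ∑ b : Z8, ∑ c : Z8, ∑ d : Z8, if Hp a b c d then
      ∑ e : Z8, if Ec a b c d e then ∑ f : Z8, F (mk3 a b c d e f) else 0 else 0 := by
  have : ∑ M ∈ I3, F M = ∑ x ∈ (Finset.univ : Finset (Z8 × Z8 × Z8 × Z8 × Z8 × Z8)).filter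
      (fun x => Hp x.1 x.2.1 x.2.2.1 x.2.2.2.1 ∧ Ec x.1 x.2.1 x.2.2.1 x.2.2.2.1 x.2.2.2.2.1),
      F (mk3 x.1 x.2.1 x.2.2.1 x.2.2.2.1 x.2.2.2.2.1 x.2.2.2.2.2) := by
    symm
    refine Finset.sum_nbij' (fun x => mk3 x.1 x.2.1 x.2.2.1 x.2.2.2.1 x.2.2.2.2.1 x.2.2.2.2.2)
      (fun g => (g 0 0, g 0 1, g 1 0, g 1 1, g 2 0, g 2 1)) ?_ ?_ ?_ ?_ ?_
    · intro x hx
      rw [mem_I3]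
      exact ⟨⟨rfl, rfl, rfl⟩, (Finset.mem_filter.1 hx).2⟩
    · intro g hg
      rw [mem_I3] at hg
      exact Finset.mem_filter.2 ⟨Finset.mem_univ _, hg.2⟩
    · intro x _; rfl
    · intro g hg
      rw [mem_I3] at hg
      obtain ⟨h1, h2, h3⟩ := hg.1
      ext i j
      fin_cases i <;> fin_cases j <;> first | rfl | exact h1.symm | exact h2.symm | exact h3.symm
    · intro x _; rfl
  rw [this, Finset.sum_filter]
  simp only [Fintype.sum_prod_type]
  refine Finset.sum_congr rfl fun a _ => Finset.sum_congr rfl fun b _ =>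
    Finset.sum_congr rfl fun c _ => Finset.sum_congr rfl fun d _ => ?_
  by_cases h : Hp a b c d
  · rw [if_pos h]
    refine Finset.sum_congr rfl fun e _ => ?_
    by_cases h2 : Ec a b c d e
    · rw [if_pos h2]; exact Finset.sum_congr rfl fun f _ => if_pos ⟨h, h2⟩
    · rw [if_neg h2]; exact Finset.sum_eq_zero fun f _ => if_neg fun h' => h2 h'.2
  · rw [if_neg h]
    exact Finset.sum_eq_zero fun e _ => Finset.sum_eq_zero fun f _ => if_neg fun h' => h h'.1

/-- minor of residues, as a natural number -/
def mN (a b c d : ℕ) : ℕ := (a * d + 256 - b * c) % 8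

def gN (A B C : ℕ) : ℕ → Bool
  | 0 => false
  | k + 1 => gN A B C k || (Nat.beq (B % 2 ^ k) 0 && !Nat.beq (B % 2 ^ (k + 1)) 0 &&
      Nat.beq (A % 2 ^ (k + 1)) 0 && Nat.beq (C % 2 ^ (k + 1)) 0)

def leafN (r A B C : ℕ) : ℕ :=
  bif gN A B C r then 21 else
    bif Nat.beq (B % 2 ^ r) 0 && Nat.beq (A % 2 ^ r) 0 && Nat.beq (C % 2 ^ r) 0 then 7 else 0

/-- natural number version of `wt` -/
def wN : ℕ → ℕ → ℕ → ℕ → ℕ → ℕ → ℕ → ℕ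
  | 0, _, _, _, _, _, _ => 3
  | r + 1, a, b, c, d, e, f =>
    bif Nat.beq (c % 2) 0 && Nat.beq (d % 2) 0 then
      bif Nat.beq (a % 2) 0 && Nat.beq (b % 2) 0 && Nat.beq (e % 2) 0 && Nat.beq (f % 2) 0 then
        wN r (a / 2) (b / 2) (c / 2) (d / 2) (e / 2) (f / 2)
      else leafN (r + 1) (mN c d e f) (mN a b e f) (mN a b c d)
    else 0

lemma mN_dvd (k a b c d : ℕ) (hk : k ≤ 3) (hb : b < 8) (hc : c < 8) :
    (2 : ℤ) ^ k ∣ (a : ℤ) * d - b * c ↔ mN a b c d % 2 ^ k = 0 := by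
  unfold mN
  have hbc : b * c ≤ 7 * 7 := Nat.mul_le_mul (by omega) (by omega)
  rw [← Nat.cast_mul, ← Nat.cast_mul]
  generalize a * d = x at *
  generalize b * c = y at *
  interval_cases k <;> norm_num <;> omega

lemma Good_succ (r : ℕ) (N : Fin 6 → ℤ) : Good (r + 1) N ↔ Good r N ∨
    (2 ^ r ∣ zB N ∧ ¬ 2 ^ (r + 1) ∣ zB N ∧ 2 ^ (r + 1) ∣ zA N ∧ 2 ^ (r + 1) ∣ zC N) := by
  constructor
  · rintro ⟨k, hk, h⟩
    rcases Nat.lt_succ_iff_lt_or_eq.1 hk with h' | rfl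
    · exact Or.inl ⟨k, h', h⟩
    · exact Or.inr h
  · rintro (⟨k, hk, h⟩ | h)
    · exact ⟨k, by omega, h⟩
    · exact ⟨r, by omega, h⟩

lemma gN_iff (a b c d e f : ℕ) (hb : b < 8) (hc : c < 8) (hd : d < 8) (he : e < 8) :
    ∀ r ≤ 3, (gN (mN c d e f) (mN a b e f) (mN a b c d) r = true ↔
      Good r ![(a : ℤ), b, c, d, e, f]) := by
  intro r
  induction r with
  | zero => intro _; simp [gN, Good]
  | succ r ih =>
    intro hr
    have hA : zA ![(a : ℤ), b, c, d, e, f] = (c : ℤ) * f - d * e := rfl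
    have hB : zB ![(a : ℤ), b, c, d, e, f] = (a : ℤ) * f - b * e := rfl
    have hC : zC ![(a : ℤ), b, c, d, e, f] = (a : ℤ) * d - b * c := rfl
    rw [Good_succ, ← ih (by omega), hA, hB, hC, mN_dvd _ a b e f (by omega) hb he,
      mN_dvd _ a b e f hr hb he, mN_dvd _ c d e f hr hd he, mN_dvd _ a b c d hr hb hc]
    simp [gN, and_assoc, ← Bool.not_eq_true]

lemma wN_eq : ∀ r ≤ 3, ∀ a b c d e f : ℕ, b < 8 → c < 8 → d < 8 → e < 8 →
    wt r a b c d e f = wN r a b c d e f := by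
  intro r
  induction r with
  | zero => intros; rfl
  | succ r ih =>
    intro hr a b c d e f hb hc hd he
    have hA : zA ![(a : ℤ), b, c, d, e, f] = (c : ℤ) * f - d * e := rfl
    have hB : zB ![(a : ℤ), b, c, d, e, f] = (a : ℤ) * f - b * e := rfl
    have hC : zC ![(a : ℤ), b, c, d, e, f] = (a : ℤ) * d - b * c := rfl
    have hi := ih (by omega) (a / 2) (b / 2) (c / 2) (d / 2) (e / 2) (f / 2) (by omega) (by omega)
      (by omega) (by omega)
    push_cast at hi
    have hp : ∀ x : ℕ, ((x : ℤ) % 2 = 0) ↔ x % 2 = 0 := by intro x; omega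
    unfold wt wN leafN
    simp only [Und, hA, hB, hC, mN_dvd _ a b e f hr hb he, mN_dvd _ c d e f hr hd he,
      mN_dvd _ a b c d hr hb hc, ← gN_iff a b c d e f hb hc hd he _ hr, hi, hp, Bool.cond_eq_ite,
      Bool.and_eq_true, Nat.beq_eq, and_assoc]

lemma wM_mk3 (a b c d e f : Z8) : wM (1 - mk3 a b c d e f) =
    wN 3 (1 - a).val (0 - b).val (0 - c).val (1 - d).val (0 - e).val (0 - f).val := by
  rw [← wN_eq 3 le_rfl _ _ _ _ _ _ (ZMod.val_lt _) (ZMod.val_lt _) (ZMod.val_lt _) (ZMod.val_lt _)]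
  rfl

lemma total : (∑ M ∈ I3, wM (1 - M)) = 81392 := by
  rw [sum_I3]
  simp only [wM_mk3]
  decide +kernel
theorem sum_over_I3_density :
    Tendsto (fun K : ℕ => (∑ M ∈ I3, (eta 3 K (1 - M) : ℝ)) / (8192 * 64 ^ (K - 3)))
      atTop (nhds (5087 / 10752)) := by
  have h : Tendsto (fun K : ℕ => (∑ M ∈ I3, (eta 3 K (1 - M) : ℝ) / 64 ^ (K - 3)) / 8192) atTop
      (nhds ((∑ M ∈ I3, ((wM (1 - M) : ℕ) / 21 : ℝ)) / 8192)) := by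
    refine (tendsto_finsetSum _ fun M hM => eta_tendsto (1 - M) ?_).div_const _
    rw [mem_I3] at hM
    obtain ⟨h1, h2, h3⟩ := hM.1
    intro i
    fin_cases i
    · exact (congrArg (fun x => (1 : Matrix (Fin 3) (Fin 3) Z8) 0 2 - x) h1).trans (by decide)
    · exact (congrArg (fun x => (1 : Matrix (Fin 3) (Fin 3) Z8) 1 2 - x) h2).trans (by decide)
    · exact (congrArg (fun x => (1 : Matrix (Fin 3) (Fin 3) Z8) 2 2 - x) h3).trans (by decide)
  rw [← Finset.sum_div, ← Nat.cast_sum, total] at h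
  convert h using 1
  · funext K
    rw [← Finset.sum_div, div_div, mul_comm]
  · norm_num
end

section
/- The group E(ℚ) of rational points of E is isomorphic to ℤ × ℤ/2ℤ; in particular, the point P = (2,2) has infinite order in E(ℚ), the point Q = (0,0) has order 2, and every element of E(ℚ) can be written as mP + nQ with m ∈ ℤ and n ∈ {0,1}. -/
/-- The elliptic curve `E : y² + xy = x³ + x² - 2x` over `ℚ`. -/
def E : WeierstrassCurve.Affine ℚ :=
  { a₁ := 1, a₂ := 1, a₃ := 0, a₄ := -2, a₆ := 0 }

/-- The point `P = (2, 2)` on `E`. -/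
noncomputable def P : E.Point :=
  WeierstrassCurve.Affine.Point.some (x := 2) (y := 2) (by
    norm_num [WeierstrassCurve.Affine.nonsingular_iff, WeierstrassCurve.Affine.equation_iff, E])

/-- The point `Q = (0, 0)` on `E`. -/
noncomputable def Q : E.Point :=
  WeierstrassCurve.Affine.Point.some (x := 0) (y := 0) (by
    norm_num [WeierstrassCurve.Affine.nonsingular_iff, WeierstrassCurve.Affine.equation_iff, E])


theorem int_of_sq (k : ℚ) (N : ℤ) (h : k ^ 2 = N) : ∃ j : ℤ, k = j ∧ j ^ 2 = N := by
  have h1 : IsSquare (N : ℚ) := ⟨k, by rw [← h]; ring⟩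
  rw [Rat.isSquare_intCast_iff] at h1
  obtain ⟨j, hj⟩ := h1
  have h2 : k ^ 2 = (j : ℚ) ^ 2 := by rw [h, hj]; push_cast; ring
  rcases sq_eq_sq_iff_eq_or_eq_neg.mp h2 with h3 | h3
  · exact ⟨j, h3, by rw [hj]; ring⟩
  · exact ⟨-j, by rw [h3]; push_cast; ring, by rw [hj]; ring⟩

/-- every curve point gives an integral square -/
theorem int_k (x y : ℚ) (h : y ^ 2 + x * y = x ^ 3 + x ^ 2 - 2 * x) :
    ∃ k : ℤ, (2 * y + x) * (x.den : ℚ) ^ 2 = k ∧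
      k ^ 2 = x.num * x.den * (4 * x.num ^ 2 + 5 * x.num * x.den - 8 * (x.den : ℤ) ^ 2) := by
  apply int_of_sq
  have hd : (x.den : ℚ) ≠ 0 := by exact_mod_cast x.den_ne_zero
  have hx : x * x.den = x.num := Rat.mul_den_eq_num x
  push_cast
  rw [← hx]
  linear_combination 4 * (x.den : ℚ) ^ 4 * h

theorem coprime_nd (x : ℚ) : IsCoprime x.num (x.den : ℤ) := by
  rw [Int.isCoprime_iff_nat_coprime]; simpa using x.reduced

theorem two_part (a b c : ℤ) (ha : a ≠ 0) (h : a * b = c ^ 2)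
    (hg : ∀ l : ℕ, l.Prime → (l : ℤ) ∣ a → (l : ℤ) ∣ b → l = 2) :
    ∃ r : ℤ, a = r ^ 2 ∨ a = - r ^ 2 ∨ a = 2 * r ^ 2 ∨ a = - (2 * r ^ 2) := by
  obtain ⟨i, a', ha', hi⟩ : ∃ (i : ℕ) (a' : ℤ), ¬ (2 : ℤ) ∣ a' ∧ a = 2 ^ i * a' := by
    have hf : FiniteMultiplicity (2 : ℤ) a := Int.finiteMultiplicity_iff.mpr ⟨by decide, ha⟩
    obtain ⟨c, h1, h2⟩ := hf.exists_eq_pow_mul_and_not_dvd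
    exact ⟨_, c, h2, h1⟩
  have hc : IsCoprime a' (2 ^ i * b) := by
    rw [Int.isCoprime_iff_gcd_eq_one]
    by_contra hne
    obtain ⟨l, hl, hld⟩ := Nat.exists_prime_and_dvd hne
    have h1 : (l : ℤ) ∣ a' := (Int.natCast_dvd_natCast.mpr hld).trans (Int.gcd_dvd_left ..)
    have h2 : (l : ℤ) ∣ 2 ^ i * b := (Int.natCast_dvd_natCast.mpr hld).trans (Int.gcd_dvd_right ..)
    have hl2 : l ≠ 2 := by rintro rfl; exact ha' (by exact_mod_cast h1)
    rcases (Nat.prime_iff_prime_int.mp hl).dvd_or_dvd h2 with h3 | h3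
    · have := (Nat.prime_iff_prime_int.mp hl).dvd_of_dvd_pow h3
      have : l ∣ 2 := by exact_mod_cast this
      exact hl2 ((Nat.prime_dvd_prime_iff_eq hl Nat.prime_two).mp this)
    · exact hl2 (hg l hl (by rw [hi]; exact h1.mul_left _) h3)
  obtain ⟨s, hs⟩ := Int.sq_of_isCoprime hc (by rw [← h, hi]; ring : a' * (2 ^ i * b) = c ^ 2)
  rcases Nat.even_or_odd' i with ⟨j, hj | hj⟩ <;> rcases hs with hs | hs <;>
    refine ⟨2 ^ j * s, ?_⟩ <;> rw [hi, hj, hs]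
  · left; ring
  · right; left; ring
  · right; right; left; ring
  · right; right; right; ring

theorem x_class (x y : ℚ) (h : y ^ 2 + x * y = x ^ 3 + x ^ 2 - 2 * x) (hx0 : x ≠ 0) :
    ∃ r : ℚ, r ≠ 0 ∧ (x = r ^ 2 ∨ x = - r ^ 2 ∨ x = 2 * r ^ 2 ∨ x = - (2 * r ^ 2)) := by
  obtain ⟨k, -, hk⟩ := int_k x y h
  have hcop := coprime_nd x
  have hp0 : x.num ≠ 0 := Rat.num_ne_zero.mpr hx0
  have hq0 : (0 : ℤ) < x.den := by exact_mod_cast x.den_pos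
  have hxe : x = (x.num : ℚ) / ((x.den : ℤ) : ℚ) := by simpa using (Rat.num_div_den x).symm
  generalize x.num = p at *
  generalize (x.den : ℤ) = q at *
  have hno : ∀ l : ℕ, l.Prime → (l : ℤ) ∣ p → (l : ℤ) ∣ q → False := by
    intro l hl h1 h2
    exact (Nat.prime_iff_prime_int.mp hl).not_isUnit (hcop.isUnit_of_dvd' h1 h2)
  have key : ∀ l : ℕ, l.Prime → (l : ℤ) ∣ 2 ^ 3 → l = 2 := by
    intro l hl h1
    have := (Nat.prime_iff_prime_int.mp hl).dvd_of_dvd_pow h1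
    have : l ∣ 2 := by exact_mod_cast this
    exact (Nat.prime_dvd_prime_iff_eq hl Nat.prime_two).mp this
  obtain ⟨r, hr⟩ := two_part p (q * (4 * p ^ 2 + 5 * p * q - 8 * q ^ 2)) k hp0 (by rw [hk]; ring) (by
    intro l hl h1 h2
    have hP := Nat.prime_iff_prime_int.mp hl
    rcases hP.dvd_or_dvd h2 with h3 | h3
    · exact (hno l hl h1 h3).elim
    · have h4 : (l : ℤ) ∣ 2 ^ 3 * q ^ 2 := by
        have h5 := (h1.mul_right (4 * p + 5 * q)).sub h3
        ring_nf at h5 ⊢; exact h5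
      rcases hP.dvd_or_dvd h4 with h5 | h5
      · exact key l hl h5
      · exact (hno l hl h1 (hP.dvd_of_dvd_pow h5)).elim)
  obtain ⟨s, hs⟩ := two_part q (p * (4 * p ^ 2 + 5 * p * q - 8 * q ^ 2)) k hq0.ne' (by rw [hk]; ring) (by
    intro l hl h1 h2
    have hP := Nat.prime_iff_prime_int.mp hl
    rcases hP.dvd_or_dvd h2 with h3 | h3
    · exact (hno l hl h3 h1).elim
    · have h4 : (l : ℤ) ∣ 2 ^ 3 * p ^ 2 := by
        have h5 := (h3.sub (h1.mul_right (5 * p - 8 * q))).mul_left 2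
        ring_nf at h5 ⊢; exact h5
      rcases hP.dvd_or_dvd h4 with h5 | h5
      · exact key l hl h5
      · exact (hno l hl (hP.dvd_of_dvd_pow h5) h1).elim)
  have hr0 : (r : ℚ) ≠ 0 := by
    intro h0
    have : r = 0 := by exact_mod_cast h0
    subst this; simp at hr; exact hp0 hr
  have hs0 : (s : ℚ) ≠ 0 := by
    intro h0
    have : s = 0 := by exact_mod_cast h0
    subst this; simp at hs; exact hq0.ne' hs
  have hs' : q = s ^ 2 ∨ q = 2 * s ^ 2 := by
    rcases hs with hs | hs | hs | hs
    · exact Or.inl hs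
    · nlinarith [sq_nonneg s]
    · exact Or.inr hs
    · nlinarith [sq_nonneg s]
  rcases hs' with hs' | hs'
  · refine ⟨r / s, div_ne_zero hr0 hs0, ?_⟩
    rw [hxe]
    rcases hr with hr | hr | hr | hr
    · left; rw [hr, hs']; push_cast; field_simp
    · right; left; rw [hr, hs']; push_cast; field_simp
    · right; right; left; rw [hr, hs']; push_cast; field_simp
    · right; right; right; rw [hr, hs']; push_cast; field_simp
  · rw [hxe]
    rcases hr with hr | hr | hr | hr
    · refine ⟨r / (2 * s), by positivity, ?_⟩
      right; right; left; rw [hr, hs']; push_cast; field_simp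
    · refine ⟨r / (2 * s), by positivity, ?_⟩
      right; right; right; rw [hr, hs']; push_cast; field_simp
    · refine ⟨r / s, by positivity, ?_⟩
      left; rw [hr, hs']; push_cast; field_simp
    · refine ⟨r / s, by positivity, ?_⟩
      right; left; rw [hr, hs']; push_cast; field_simp

theorem core_sq (A B e : ℤ) (hA : 0 < A) (hB : 0 < B) (hc : IsCoprime A B)
    (h : A * B = 153 * e ^ 4) : (∃ z, A = z ^ 2) ∨ (∃ z, B = z ^ 2) := by
  have aux : ∀ A B : ℤ, 0 < A → 0 < B → IsCoprime A B → A * B = 153 * e ^ 4 → 17 ∣ A →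
      ∃ z, B = z ^ 2 := by
    rintro A B hA hB hc h ⟨A', rfl⟩
    have h1 : B * A' = (3 * e ^ 2) ^ 2 := by nlinarith
    have h2 : IsCoprime B A' := (hc.of_mul_left_right).symm
    obtain ⟨z, hz | hz⟩ := Int.sq_of_isCoprime h2 h1
    · exact ⟨z, hz⟩
    · nlinarith [sq_nonneg z]
  have h17 : Prime (17 : ℤ) := by norm_num
  have : (17 : ℤ) ∣ A * B := ⟨9 * e ^ 4, by rw [h]; ring⟩
  rcases h17.dvd_or_dvd this with h1 | h1
  · exact Or.inr (aux A B hA hB hc h h1)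
  · exact Or.inl (aux B A hB hA hc.symm (by rw [mul_comm]; exact h) h1)

theorem cop_of (A B e m : ℤ) (c : ℕ) (hme : IsCoprime m e) (h : A * B = 153 * e ^ 4)
    (hs : A + B = c * m ^ 2 + 10 * e ^ 2) (hc : c = 16 ∨ c = 4 ∨ c = 1) (ho : Odd e ∨ c = 1) :
    IsCoprime A B := by
  rw [Int.isCoprime_iff_gcd_eq_one]
  by_contra hne
  obtain ⟨l, hl, hld⟩ := Nat.exists_prime_and_dvd hne
  have h1 : (l : ℤ) ∣ A := (Int.natCast_dvd_natCast.mpr hld).trans (Int.gcd_dvd_left ..)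
  have h2 : (l : ℤ) ∣ B := (Int.natCast_dvd_natCast.mpr hld).trans (Int.gcd_dvd_right ..)
  have hP := Nat.prime_iff_prime_int.mp hl
  have hno : (l : ℤ) ∣ m → (l : ℤ) ∣ e → False := fun h1 h2 =>
    hP.not_isUnit (hme.isUnit_of_dvd' h1 h2)
  have hle : ¬ (l : ℤ) ∣ e := by
    intro he
    have h3 : (l : ℤ) ∣ c * m ^ 2 := by
      have := (h1.add h2).sub (he.mul_left (10 * e))
      rw [hs] at this; ring_nf at this ⊢; exact this
    rcases hP.dvd_or_dvd h3 with h4 | h4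
    · have h5 : l ∣ c := by exact_mod_cast h4
      rcases ho with ho | ho
      · have h6 : l = 2 := by
          have : l ∣ 2 ^ 4 := h5.trans (by rcases hc with rfl | rfl | rfl <;> decide)
          exact (Nat.prime_dvd_prime_iff_eq hl Nat.prime_two).mp (hl.dvd_of_dvd_pow this)
        subst h6
        obtain ⟨t, rfl⟩ := ho
        obtain ⟨s, hs⟩ := he
        push_cast at hs; omega
      · rw [ho] at h5; exact hl.one_lt.ne' (Nat.dvd_one.mp h5)
    · exact hno (hP.dvd_of_dvd_pow h4) he
  have h4 : ((l : ℤ)) ^ 2 ∣ 153 * e ^ 4 := by rw [← h, sq]; exact mul_dvd_mul h1 h2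
  have h5 : IsCoprime ((l : ℤ) ^ 2) (e ^ 4) :=
    (((Prime.coprime_iff_not_dvd hP).mpr hle).pow)
  have h6 := h5.dvd_of_dvd_mul_right h4
  have h7 : l ^ 2 ∣ 153 := by exact_mod_cast h6
  have h8 : l ≤ 12 := by
    have := Nat.le_of_dvd (by norm_num) h7
    nlinarith
  have h9 : l = 3 := by
    interval_cases l <;> revert h7 hl <;> decide
  subst h9
  have h10 : (3 : ℤ) ∣ m ^ 2 + e ^ 2 := by
    have := h1.add h2
    rw [hs] at this
    rcases hc with rfl | rfl | rfl <;> push_cast at this <;> omega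
  apply hle
  push_cast
  have hm : m % 3 = 0 ∨ m % 3 = 1 ∨ m % 3 = 2 := by omega
  have he : e % 3 = 0 ∨ e % 3 = 1 ∨ e % 3 = 2 := by omega
  have h11 := Int.emod_eq_zero_of_dvd h10
  rcases hm with hm | hm | hm <;> rcases he with he | he | he <;>
    simp [sq, Int.add_emod, Int.mul_emod, hm, he] at h11 ⊢ <;> omega

theorem quartic_sq (w d : ℚ) (h : d ^ 2 = 4 * w ^ 4 + 5 * w ^ 2 - 8) :
    ∃ z : ℚ, 8 * w ^ 2 + 5 + 4 * d = z ^ 2 ∨ 8 * w ^ 2 + 5 - 4 * d = z ^ 2 := by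
  have hcop := coprime_nd w
  have he0 : (0 : ℤ) < w.den := by exact_mod_cast w.den_pos
  have hxe : w * ((w.den : ℤ) : ℚ) = w.num := by simp
  generalize w.num = m at *
  generalize (w.den : ℤ) = e at *
  have heq : (e : ℚ) ≠ 0 := by exact_mod_cast he0.ne'
  obtain ⟨n, hn1, hn2⟩ := int_of_sq (d * e ^ 2) (4 * m ^ 4 + 5 * m ^ 2 * e ^ 2 - 8 * e ^ 4) (by
    push_cast; rw [← hxe]; linear_combination (e : ℚ) ^ 4 * h)
  have fin : ∀ (f z : ℤ) , f ≠ 0 → (8 * m ^ 2 + 5 * e ^ 2 + 4 * n) * f ^ 2 = z ^ 2 * e ^ 2 ∨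
      (8 * m ^ 2 + 5 * e ^ 2 - 4 * n) * f ^ 2 = z ^ 2 * e ^ 2 →
      ∃ z : ℚ, 8 * w ^ 2 + 5 + 4 * d = z ^ 2 ∨ 8 * w ^ 2 + 5 - 4 * d = z ^ 2 := by
    intro f z hf h
    have hfq : (f : ℚ) ≠ 0 := by exact_mod_cast hf
    refine ⟨z / f, ?_⟩
    rcases h with h | h
    · left
      have h' : (8 * (m : ℚ) ^ 2 + 5 * e ^ 2 + 4 * n) * f ^ 2 = z ^ 2 * e ^ 2 := by exact_mod_cast h
      rw [← hxe, ← hn1] at h'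
      rw [div_pow, eq_div_iff (by positivity)]
      have : (e : ℚ) ^ 2 ≠ 0 := by positivity
      apply mul_left_cancel₀ this
      linear_combination h'
    · right
      have h' : (8 * (m : ℚ) ^ 2 + 5 * e ^ 2 - 4 * n) * f ^ 2 = z ^ 2 * e ^ 2 := by exact_mod_cast h
      rw [← hxe, ← hn1] at h'
      rw [div_pow, eq_div_iff (by positivity)]
      have : (e : ℚ) ^ 2 ≠ 0 := by positivity
      apply mul_left_cancel₀ this
      linear_combination h'
  have pos : ∀ A B N : ℤ, A * B = N → 0 < A + B → 0 < N → 0 < A ∧ 0 < B := by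
    rintro A B N rfl h1 h2
    constructor <;> by_contra hh <;> nlinarith
  rcases Int.even_or_odd' e with ⟨f, rfl | hodd⟩
  swap
  · have hAB : (8 * m ^ 2 + 5 * e ^ 2 + 4 * n) * (8 * m ^ 2 + 5 * e ^ 2 - 4 * n) = 153 * e ^ 4 := by
      linear_combination -16 * hn2
    obtain ⟨h1, h2⟩ := pos _ _ _ hAB (by nlinarith [sq_nonneg m, sq_nonneg e]) (by positivity)
    have hc := cop_of _ _ e m 16 hcop hAB (by push_cast; ring) (by simp) (Or.inl ⟨f, hodd⟩)
    rcases core_sq _ _ e h1 h2 hc hAB with ⟨z, hz⟩ | ⟨z, hz⟩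
    · exact fin e z he0.ne' (Or.inl (by rw [hz]))
    · exact fin e z he0.ne' (Or.inr (by rw [hz]))
  have hf0 : 0 < f := by omega
  have hcf : IsCoprime m f := hcop.of_mul_right_right
  have hmodd : Odd m := by
    rw [← Int.not_even_iff_odd]
    rintro ⟨t, rfl⟩
    have := hcop.isUnit_of_dvd' (x := 2) ⟨t, by ring⟩ ⟨f, by ring⟩
    exact absurd this (by decide)
  obtain ⟨n', rfl⟩ : ∃ n', n = 2 * n' := by
    have h1 : Even (n ^ 2) := by
      rw [hn2]; exact ⟨2 * m ^ 4 + 10 * m ^ 2 * f ^ 2 - 64 * f ^ 4, by ring⟩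
    obtain ⟨t, ht⟩ := (Int.even_pow.mp h1).1
    exact ⟨t, by omega⟩
  have hn3 : n' ^ 2 = m ^ 4 + 5 * m ^ 2 * f ^ 2 - 32 * f ^ 4 := by linarith
  rcases Int.even_or_odd' f with ⟨g, rfl | hodd⟩
  swap
  · have hAB : (2 * m ^ 2 + 5 * f ^ 2 + 2 * n') * (2 * m ^ 2 + 5 * f ^ 2 - 2 * n') = 153 * f ^ 4 := by
      linear_combination -4 * hn3
    obtain ⟨h1, h2⟩ := pos _ _ _ hAB (by nlinarith [sq_nonneg m, sq_nonneg f]) (by positivity)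
    have hc := cop_of _ _ f m 4 hcf hAB (by push_cast; ring) (by simp) (Or.inl ⟨g, hodd⟩)
    rcases core_sq _ _ f h1 h2 hc hAB with ⟨z, hz⟩ | ⟨z, hz⟩
    · exact fin f z hf0.ne' (Or.inl (by linear_combination 4 * f ^ 2 * hz))
    · exact fin f z hf0.ne' (Or.inr (by linear_combination 4 * f ^ 2 * hz))
  have hg0 : 0 < g := by omega
  have hcg : IsCoprime m g := hcf.of_mul_right_right
  obtain ⟨s, hs⟩ := hmodd
  have hn'odd : Odd n' := by
    have h1 : Odd (n' ^ 2) := by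
      rw [hn3, hs]
      exact ⟨8 * s ^ 4 + 16 * s ^ 3 + 12 * s ^ 2 + 4 * s + 10 * (2 * s + 1) ^ 2 * g ^ 2 - 256 * g ^ 4,
        by ring⟩
    exact (Int.odd_pow.mp h1).resolve_right (by norm_num)
  obtain ⟨t, ht⟩ := hn'odd
  obtain ⟨a, ha⟩ : ∃ a, m ^ 2 + n' = 2 * a := ⟨2 * s ^ 2 + 2 * s + t + 1, by rw [hs, ht]; ring⟩
  obtain ⟨b, hb⟩ : ∃ b, m ^ 2 - n' = 2 * b := ⟨2 * s ^ 2 + 2 * s - t, by rw [hs, ht]; ring⟩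
  have hAB : (a + 5 * g ^ 2) * (b + 5 * g ^ 2) = 153 * g ^ 4 := by
    have : n' = a - b := by linarith
    have h2 : m ^ 2 = a + b := by linarith
    have h3 : n' ^ 2 = (m ^ 2) ^ 2 + 20 * (m ^ 2) * g ^ 2 - 512 * g ^ 4 := by rw [hn3]; ring
    rw [h2, this] at h3
    linarith
  obtain ⟨h1, h2⟩ := pos _ _ _ hAB (by nlinarith [sq_nonneg m, sq_nonneg g]) (by positivity)
  have hc := cop_of _ _ g m 1 hcg hAB (by push_cast; linarith) (by simp) (Or.inr rfl)
  rcases core_sq _ _ g h1 h2 hc hAB with ⟨z, hz⟩ | ⟨z, hz⟩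
  · exact fin g z hg0.ne' (Or.inl (by linear_combination 8 * g ^ 2 * ha + 16 * g ^ 2 * hz))
  · exact fin g z hg0.ne' (Or.inr (by linear_combination 8 * g ^ 2 * hb + 16 * g ^ 2 * hz))

open WeierstrassCurve.Affine in
theorem ns_iff (x y : ℚ) : E.Nonsingular x y ↔ y ^ 2 + x * y = x ^ 3 + x ^ 2 - 2 * x := by
  have hE : E.Δ ≠ 0 := by
    norm_num [WeierstrassCurve.Δ, WeierstrassCurve.b₂, WeierstrassCurve.b₄, WeierstrassCurve.b₆,
      WeierstrassCurve.b₈, E]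
  rw [← equation_iff_nonsingular_of_Δ_ne_zero hE, equation_iff]
  simp only [E]
  constructor <;> intro h <;> linarith

abbrev mk (x y : ℚ) (h : y ^ 2 + x * y = x ^ 3 + x ^ 2 - 2 * x) : E.Point :=
  WeierstrassCurve.Affine.Point.some x y ((ns_iff x y).mpr h)

theorem mk_cases (R : E.Point) : R = 0 ∨ ∃ x y h, R = mk x y h := by
  rcases R with _ | ⟨x, y, h⟩
  · exact Or.inl rfl
  · exact Or.inr ⟨x, y, (ns_iff x y).mp h, rfl⟩

theorem mk_congr {x y x' y' : ℚ} {h} (hx : x = x') (hy : y = y') :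
    mk x y h = mk x' y' (by rw [← hx, ← hy]; exact h) := by
  subst hx hy; rfl

theorem cv_congr {x y x' : ℚ} (hx : x = x') (h : y ^ 2 + x * y = x ^ 3 + x ^ 2 - 2 * x) :
    y ^ 2 + x' * y = x' ^ 3 + x' ^ 2 - 2 * x' := by
  subst hx; exact h

theorem neg_mk (x y : ℚ) (h) : - mk x y h = mk x (-y - x) (by linarith) := by
  have hn : E.negY x y = -y - x := by simp [WeierstrassCurve.Affine.negY, E]
  rw [mk, WeierstrassCurve.Affine.Point.neg_some]
  congr 1

theorem mk_x_eq {x y y' : ℚ} (h h') : mk x y h = mk x y' h' ∨ mk x y h = - mk x y' h' := by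
  have := (WeierstrassCurve.Affine.Point.X_eq_iff (h₁ := (ns_iff x y).mpr h)
    (h₂ := (ns_iff x y').mpr h')).mp rfl
  exact this

theorem mk_add {x₁ y₁ x₂ y₂ : ℚ} (h₁ h₂) (hx : x₁ ≠ x₂) (l : ℚ) (hl : l * (x₁ - x₂) = y₁ - y₂) :
    ∃ h, mk x₁ y₁ h₁ + mk x₂ y₂ h₂ =
      mk (l ^ 2 + l - 1 - x₁ - x₂) (-(l * (l ^ 2 + l - 1 - x₁ - x₂ - x₁) + y₁)
        - (l ^ 2 + l - 1 - x₁ - x₂)) h := by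
  have hl' : l = (y₁ - y₂) / (x₁ - x₂) := by
    rw [eq_div_iff (sub_ne_zero.mpr hx)]; exact hl
  have key := WeierstrassCurve.Affine.Point.add_of_X_ne (h₁ := (ns_iff x₁ y₁).mpr h₁)
    (h₂ := (ns_iff x₂ y₂).mpr h₂) hx
  have hX : E.addX x₁ x₂ (E.slope x₁ x₂ y₁ y₂) = l ^ 2 + l - 1 - x₁ - x₂ := by
    rw [WeierstrassCurve.Affine.slope_of_X_ne hx, ← hl']
    simp [WeierstrassCurve.Affine.addX, E]
  have hY : E.addY x₁ x₂ y₁ (E.slope x₁ x₂ y₁ y₂) = -(l * (l ^ 2 + l - 1 - x₁ - x₂ - x₁) + y₁)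
        - (l ^ 2 + l - 1 - x₁ - x₂) := by
    rw [WeierstrassCurve.Affine.addY, WeierstrassCurve.Affine.negAddY, hX,
      WeierstrassCurve.Affine.slope_of_X_ne hx, ← hl']
    simp [WeierstrassCurve.Affine.negY, E]
  have hn := WeierstrassCurve.Affine.nonsingular_add ((ns_iff x₁ y₁).mpr h₁)
    ((ns_iff x₂ y₂).mpr h₂) (fun h => hx h.1)
  rw [hX, hY] at hn
  refine ⟨(ns_iff _ _).mp hn, ?_⟩
  rw [mk, mk, key]
  congr 1

theorem mk_dbl {x y : ℚ} (h) (hy : 2 * y + x ≠ 0) :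
    ∃ y' h', mk x y h + mk x y h = mk ((x ^ 2 + 2) ^ 2 / (2 * y + x) ^ 2) y' h' := by
  have hy' : y ≠ E.negY x y := by
    simp only [WeierstrassCurve.Affine.negY, E]
    intro h0; apply hy; linarith
  have key := WeierstrassCurve.Affine.Point.add_self_of_Y_ne (h₁ := (ns_iff x y).mpr h) hy'
  have hX : E.addX x x (E.slope x x y y) = (x ^ 2 + 2) ^ 2 / (2 * y + x) ^ 2 := by
    rw [WeierstrassCurve.Affine.slope_of_Y_ne rfl hy']
    have : y - E.negY x y = 2 * y + x := by simp [WeierstrassCurve.Affine.negY, E]; ring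
    rw [this]
    simp only [WeierstrassCurve.Affine.addX, E]
    field_simp
    linear_combination (-(8 * x + 5)) * h
  have hn := WeierstrassCurve.Affine.nonsingular_add ((ns_iff x y).mpr h)
    ((ns_iff x y).mpr h) (fun h => hy' h.2)
  rw [hX] at hn
  refine ⟨_, (ns_iff _ _).mp hn, ?_⟩
  rw [mk, mk, key]
  congr 1

theorem mk_dbl_zero {x y : ℚ} (h) (hy : 2 * y + x = 0) : mk x y h + mk x y h = 0 := by
  apply WeierstrassCurve.Affine.Point.add_self_of_Y_eq
  simp only [WeierstrassCurve.Affine.negY, E]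
  linarith

theorem P_eq : P = mk 2 2 (by norm_num) := rfl
theorem Q_eq : Q = mk 0 0 (by norm_num) := rfl
theorem QQ : Q + Q = 0 := mk_dbl_zero (x := 0) (y := 0) (by norm_num) (by norm_num)
theorem PQ_eq : P + Q = mk (-1) 2 (by norm_num) := by
  rw [P_eq, Q_eq]
  obtain ⟨h, e⟩ := mk_add (x₁ := 2) (y₁ := 2) (x₂ := 0) (y₂ := 0) (by norm_num) (by norm_num)
    (by norm_num) 1 (by norm_num)
  rw [e]; apply mk_congr <;> norm_num

theorem half (w y : ℚ) (hw : w ≠ 0) (h) : ∃ S : E.Point, mk (w ^ 2) y h = S + S := by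
  obtain ⟨d, hd⟩ : ∃ d, d * w = 2 * y + w ^ 2 := ⟨(2 * y + w ^ 2) / w, by field_simp⟩
  have hd2 : d ^ 2 = 4 * w ^ 4 + 5 * w ^ 2 - 8 := by
    have : w ^ 2 ≠ 0 := by positivity
    apply mul_left_cancel₀ this
    linear_combination (d * w + 2 * y + w ^ 2) * hd + 4 * h
  obtain ⟨z, hz⟩ := quartic_sq w d hd2
  have hrel : z ^ 4 - 2 * z ^ 2 * (8 * w ^ 2 + 5) + 153 = 0 := by
    rcases hz with hz | hz
    · have : (z ^ 2 - 8 * w ^ 2 - 5) ^ 2 = 16 * d ^ 2 := by rw [← hz]; ring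
      rw [hd2] at this; linear_combination this
    · have : (z ^ 2 - 8 * w ^ 2 - 5) ^ 2 = 16 * d ^ 2 := by rw [← hz]; ring
      rw [hd2] at this; linear_combination this
  obtain ⟨u, hu⟩ : ∃ u, u = (z ^ 2 - 5 + 4 * w * z) / 8 := ⟨_, rfl⟩
  have h1 : u ^ 2 + 2 = w * z * u := by rw [hu]; linear_combination hrel / 64
  have h2 : z ^ 2 * u = 4 * u ^ 2 + 5 * u - 8 := by rw [hu]; linear_combination hrel / 16
  have hu0 : u ≠ 0 := by rintro h0; rw [h0] at h1; norm_num at h1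
  have hz0 : z ≠ 0 := by rintro h0; rw [h0] at hrel; norm_num at hrel
  have hc : ((z * u - u) / 2) ^ 2 + u * ((z * u - u) / 2) = u ^ 3 + u ^ 2 - 2 * u := by
    linear_combination u / 4 * h2
  have hy : 2 * ((z * u - u) / 2) + u ≠ 0 := by
    have : 2 * ((z * u - u) / 2) + u = z * u := by ring
    rw [this]; positivity
  obtain ⟨y', h', e⟩ := mk_dbl hc hy
  have hx : (u ^ 2 + 2) ^ 2 / (2 * ((z * u - u) / 2) + u) ^ 2 = w ^ 2 := by
    rw [div_eq_iff (by positivity), h1]; ring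
  rw [mk_congr hx rfl] at e
  rcases mk_x_eq h (cv_congr hx h') with h3 | h3
  · exact ⟨_, h3.trans e.symm⟩
  · refine ⟨- mk u _ hc, ?_⟩
    rw [h3, ← e]; abel

theorem add_Q (x y : ℚ) (h) (hx : x ≠ 0) : ∃ y' h', mk x y h + Q = mk (-2 / x) y' h' := by
  obtain ⟨h', e⟩ := mk_add h (by norm_num : (0 : ℚ) ^ 2 + 0 * 0 = 0 ^ 3 + 0 ^ 2 - 2 * 0) hx (y / x)
    (by field_simp; ring)
  have : (y / x) ^ 2 + y / x - 1 - x - 0 = -2 / x := by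
    field_simp; linear_combination h
  rw [mk_congr this rfl] at e
  exact ⟨_, _, e⟩

theorem add_gen (x y x₀ y₀ : ℚ) (h h₀) (hx : x ≠ x₀) :
    ∃ x' y' h' n, mk x y h + mk x₀ y₀ h₀ = mk x' y' h' ∧ x * x₀ * x' = n ^ 2 ∧
      n * (x - x₀) = x * y₀ - y * x₀ := by
  have hx' : x - x₀ ≠ 0 := sub_ne_zero.mpr hx
  obtain ⟨l, hl⟩ : ∃ l, l * (x - x₀) = y - y₀ := ⟨(y - y₀) / (x - x₀), by field_simp⟩
  obtain ⟨h', e⟩ := mk_add h h₀ hx l hl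
  refine ⟨_, _, h', y - l * x, e, ?_, by linear_combination -x * hl⟩
  apply mul_left_cancel₀ hx'
  have hy : y = y₀ + l * (x - x₀) := by linarith
  subst hy
  linear_combination x₀ * h - x * h₀

theorem four_cosets (R : E.Point) : ∃ S : E.Point,
    R = S + S ∨ R + Q = S + S ∨ R + P = S + S ∨ R + (P + Q) = S + S := by
  rcases mk_cases R with rfl | ⟨x, y, h, rfl⟩
  · exact ⟨0, Or.inl (by simp)⟩
  by_cases hx : x = 0
  · subst hx
    have hy : y = 0 := by simpa using h
    subst hy
    exact ⟨0, Or.inr (Or.inl (by rw [← Q_eq, QQ]; simp))⟩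
  obtain ⟨r, hr, hc⟩ := x_class x y h hx
  rcases hc with rfl | rfl | rfl | rfl
  · obtain ⟨S, hS⟩ := half r y hr h
    exact ⟨S, Or.inl hS⟩
  · by_cases h1 : - r ^ 2 = (-1 : ℚ)
    · rw [mk_congr h1 rfl, PQ_eq]
      rcases mk_x_eq (x := -1) (y := y) (y' := 2) (cv_congr h1 h) (by norm_num) with h2 | h2
      · exact ⟨_, Or.inr (Or.inr (Or.inr (by rw [h2]))) ⟩
      · exact ⟨0, Or.inr (Or.inr (Or.inr (by rw [h2]; simp))) ⟩
    · obtain ⟨x', y', h', n, e, hn, hn'⟩ := add_gen _ y (-1) 2 h (by norm_num) h1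
      have hx' : x' = (n / r) ^ 2 := by field_simp; linear_combination hn
      have hn0 : n ≠ 0 := by
        rintro rfl
        have hy : y = 2 * r ^ 2 := by linarith
        subst hy
        have : r ^ 2 * (r ^ 2 - 1) * (r ^ 2 + 2) = 0 := by linear_combination h
        have h3 : r ^ 2 - 1 ≠ 0 := fun h4 => h1 (by linarith)
        have h4 : r ^ 2 + 2 ≠ 0 := by positivity
        have h5 : r ^ 2 ≠ 0 := by positivity
        exact (mul_ne_zero (mul_ne_zero h5 h3) h4) this
      subst hx'
      obtain ⟨S, hS⟩ := half _ y' (div_ne_zero hn0 hr) h'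
      exact ⟨S, Or.inr (Or.inr (Or.inr (by rw [PQ_eq, e, hS])))⟩
  · by_cases h1 : 2 * r ^ 2 = (2 : ℚ)
    · rw [mk_congr h1 rfl, P_eq]
      rcases mk_x_eq (x := 2) (y := y) (y' := 2) (cv_congr h1 h) (by norm_num) with h2 | h2
      · exact ⟨_, Or.inr (Or.inr (Or.inl (by rw [h2]))) ⟩
      · exact ⟨0, Or.inr (Or.inr (Or.inl (by rw [h2]; simp))) ⟩
    · obtain ⟨x', y', h', n, e, hn, hn'⟩ := add_gen _ y 2 2 h (by norm_num) h1
      have hx' : x' = (n / (2 * r)) ^ 2 := by field_simp; linear_combination hn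
      have hn0 : n ≠ 0 := by
        rintro rfl
        have hy : y = 2 * r ^ 2 := by linarith
        subst hy
        have : r ^ 2 * (r ^ 2 - 1) * (2 * r ^ 2 + 1) = 0 := by linear_combination - h / 4
        have h3 : r ^ 2 - 1 ≠ 0 := fun h4 => h1 (by linarith)
        have h4 : 2 * r ^ 2 + 1 ≠ 0 := by positivity
        have h5 : r ^ 2 ≠ 0 := by positivity
        exact (mul_ne_zero (mul_ne_zero h5 h3) h4) this
      subst hx'
      obtain ⟨S, hS⟩ := half _ y' (div_ne_zero hn0 (by positivity)) h'
      exact ⟨S, Or.inr (Or.inr (Or.inl (by rw [P_eq, e, hS])))⟩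
  · obtain ⟨y', h', e⟩ := add_Q _ y h hx
    have hx' : -2 / (-(2 * r ^ 2)) = (1 / r) ^ 2 := by field_simp
    rw [mk_congr hx' rfl] at e
    obtain ⟨S, hS⟩ := half (1 / r) y' (by positivity) (cv_congr hx' h')
    exact ⟨S, Or.inr (Or.inl (e.trans hS))⟩

/-- naive height of a rational number -/
def hq (x : ℚ) : ℤ := max |x.num| x.den

theorem hq_pos (x : ℚ) : 0 < hq x :=
  lt_of_lt_of_le (by exact_mod_cast x.den_pos) (le_max_right _ _)

theorem fin612 : ∀ n ∈ Finset.range 613, n ∣ 612 → ¬ 4 ∣ n → ¬ 9 ∣ n → ¬ 17 ∣ n → n ∣ 6 := by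
  decide +kernel

theorem gcd_six (p q k c : ℤ) (hpq : IsCoprime p q)
    (hk : k ^ 2 = p * q * (4 * p ^ 2 + 5 * p * q - 8 * q ^ 2))
    (hcA : c ∣ p ^ 2 + 2 * q ^ 2) (hck : c ∣ k) : c ∣ 6 := by
  have hno : ∀ l : ℤ, ¬ IsUnit l → l ∣ p → l ∣ q → False := fun l hl h1 h2 =>
    hl (hpq.isUnit_of_dvd' h1 h2)
  have hcq : IsCoprime c q := by
    have h1 : IsCoprime (p ^ 2 + 2 * q ^ 2) q := by
      have : IsCoprime (p ^ 2 + (2 * q) * q) q := (hpq.pow_left).add_mul_right_left (2 * q)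
      convert this using 1; ring
    exact h1.of_isCoprime_of_dvd_left hcA
  have hc612 : c ∣ 612 := by
    have h1 : c ∣ q * (p * (4 * p ^ 2 + 5 * p * q - 8 * q ^ 2)) := by
      have : c ∣ k ^ 2 := hck.trans (dvd_pow_self _ two_ne_zero)
      rw [hk] at this; convert this using 1; ring
    have h2 := hcq.dvd_of_dvd_mul_left h1
    have h3 : c ∣ q ^ 2 * (2 * (4 * p ^ 2 + 5 * p * q - 8 * q ^ 2)) := by
      have := Int.dvd_sub (hcA.mul_right (4 * p ^ 2 + 5 * p * q - 8 * q ^ 2)) (h2.mul_left p)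
      convert this using 1; ring
    have h4 := (hcq.pow_right).dvd_of_dvd_mul_left h3
    have h5 : c ∣ q * (2 * (5 * p - 16 * q)) := by
      have := Int.dvd_sub h4 (hcA.mul_left 8)
      convert this using 1; ring
    have h6 := hcq.dvd_of_dvd_mul_left h5
    have h7 : c ∣ q ^ 2 * 612 := by
      have := Int.dvd_sub (hcA.mul_left 50) (h6.mul_right (5 * p + 16 * q))
      convert this using 1; ring
    exact (hcq.pow_right).dvd_of_dvd_mul_left h7
  have hcc : c ^ 2 ∣ p * q * (4 * p ^ 2 + 5 * p * q - 8 * q ^ 2) := by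
    rw [← hk]; exact pow_dvd_pow_of_dvd hck 2
  have h4 : ¬ (4 : ℤ) ∣ c := by
    intro h
    obtain ⟨t, ht⟩ := h.trans hcA
    rcases Int.even_or_odd' p with ⟨a, rfl | rfl⟩
    · rcases Int.even_or_odd' q with ⟨b, rfl | rfl⟩
      · exact hno 2 (by decide) ⟨a, rfl⟩ ⟨b, rfl⟩
      · ring_nf at ht; omega
    · ring_nf at ht; omega
  have prm : ∀ l : ℤ, Prime l → ¬ l ∣ 2 → l ∣ c → ¬ l ∣ q ∧ l ^ 2 ∣ 4 * p ^ 2 + 5 * p * q - 8 * q ^ 2 := by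
    intro l hl hl2 hlc
    have hq : ¬ l ∣ q := fun h => hl.not_isUnit (hcq.isUnit_of_dvd' hlc h)
    have hp : ¬ l ∣ p := by
      intro h
      have h1 : l ∣ 2 * q ^ 2 := by
        have := Int.dvd_sub (hlc.trans hcA) (h.mul_left p)
        convert this using 1; ring
      rcases hl.dvd_or_dvd h1 with h2 | h2
      · exact hl2 h2
      · exact hq (hl.dvd_of_dvd_pow h2)
    refine ⟨hq, ?_⟩
    have h1 : l ^ 2 ∣ p * q * (4 * p ^ 2 + 5 * p * q - 8 * q ^ 2) :=
      (pow_dvd_pow_of_dvd hlc 2).trans hcc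
    have h2 : IsCoprime (l ^ 2) (p * q) := by
      apply IsCoprime.pow_left
      exact IsCoprime.mul_right ((Prime.coprime_iff_not_dvd hl).mpr hp)
        ((Prime.coprime_iff_not_dvd hl).mpr hq)
    exact h2.dvd_of_dvd_mul_left h1
  have h17 : ¬ (17 : ℤ) ∣ c := by
    intro h
    have hP : Prime (17 : ℤ) := by norm_num
    obtain ⟨hq, f, hf⟩ := prm 17 hP (by norm_num) h
    have h1 : (17 : ℤ) ∣ (8 * p + 5 * q) ^ 2 := ⟨16 * 17 * f + 9 * q ^ 2, by linear_combination 16 * hf⟩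
    obtain ⟨s, hs⟩ := hP.dvd_of_dvd_pow h1
    have h2 : (17 : ℤ) ∣ 9 * q ^ 2 := by
      refine ⟨s ^ 2 - 16 * f, ?_⟩
      have : (8 * p + 5 * q) ^ 2 = (17 * s) ^ 2 := by rw [hs]
      nlinarith
    rcases hP.dvd_or_dvd h2 with h3 | h3
    · norm_num at h3
    · exact hq (hP.dvd_of_dvd_pow h3)
  have h9 : ¬ (9 : ℤ) ∣ c := by
    intro h
    have hP : Prime (3 : ℤ) := Int.prime_three
    obtain ⟨hq, -⟩ := prm 3 hP (by norm_num) ((by norm_num : (3 : ℤ) ∣ 9).trans h)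
    have hp : ¬ (3 : ℤ) ∣ p := by
      intro h0
      have h1 : (3 : ℤ) ∣ 2 * q ^ 2 := by
        have := Int.dvd_sub (((by norm_num : (3 : ℤ) ∣ 9).trans h).trans hcA) (h0.mul_left p)
        convert this using 1; ring
      rcases hP.dvd_or_dvd h1 with h2 | h2
      · norm_num at h2
      · exact hq (hP.dvd_of_dvd_pow h2)
    have h1 : (9 : ℤ) ^ 2 ∣ p * q * (4 * p ^ 2 + 5 * p * q - 8 * q ^ 2) :=
      (pow_dvd_pow_of_dvd h 2).trans hcc
    have h2 : IsCoprime ((9 : ℤ) ^ 2) (p * q) := by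
      have : ((9 : ℤ) ^ 2) = 3 ^ 4 := by norm_num
      rw [this]
      apply IsCoprime.pow_left
      exact IsCoprime.mul_right ((Prime.coprime_iff_not_dvd hP).mpr hp)
        ((Prime.coprime_iff_not_dvd hP).mpr hq)
    obtain ⟨f, hf⟩ := h2.dvd_of_dvd_mul_left h1
    have h1 : (3 : ℤ) ∣ (8 * p + 5 * q) ^ 2 :=
      ⟨16 * 27 * f + 51 * q ^ 2, by linear_combination 16 * hf⟩
    obtain ⟨s, hs⟩ := hP.dvd_of_dvd_pow h1
    have h2 : s ^ 2 = 144 * f + 17 * q ^ 2 := by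
      have : (8 * p + 5 * q) ^ 2 = (3 * s) ^ 2 := by rw [hs]
      nlinarith
    have h11 : (s ^ 2 + q ^ 2) % 3 = 0 := by omega
    apply hq
    have hm : s % 3 = 0 ∨ s % 3 = 1 ∨ s % 3 = 2 := by omega
    have he : q % 3 = 0 ∨ q % 3 = 1 ∨ q % 3 = 2 := by omega
    rcases hm with hm | hm | hm <;> rcases he with he | he | he <;>
      simp [sq, Int.add_emod, Int.mul_emod, hm, he] at h11 ⊢ <;> omega
  have hn : c.natAbs ∣ 612 := by
    have := Int.natAbs_dvd_natAbs.mpr hc612; simpa using this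
  have := fin612 c.natAbs (by
    have := Nat.le_of_dvd (by norm_num) hn
    simp; omega) hn (fun h => h4 (by omega)) (fun h => h9 (by omega)) (fun h => h17 (by omega))
  have h6 : ((c.natAbs : ℕ) : ℤ) ∣ ((6 : ℕ) : ℤ) := Int.natCast_dvd_natCast.mpr this
  exact (Int.natAbs_dvd.mp h6)

theorem dbl_height (u v : ℚ) (h : v ^ 2 + u * v = u ^ 3 + u ^ 2 - 2 * u) (hv : 2 * v + u ≠ 0) :
    hq u ^ 4 ≤ 36 * hq ((u ^ 2 + 2) ^ 2 / (2 * v + u) ^ 2) := by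
  obtain ⟨k, hk1, hk2⟩ := int_k u v h
  have hcop := coprime_nd u
  have hd : (u.den : ℚ) ≠ 0 := by exact_mod_cast u.den_ne_zero
  have hdpos : (0 : ℤ) < u.den := by exact_mod_cast u.den_pos
  have hx : u * u.den = u.num := Rat.mul_den_eq_num u
  have hk0 : k ≠ 0 := by
    rintro rfl
    have : (2 * v + u) * (u.den : ℚ) ^ 2 ≠ 0 := by positivity
    exact this (by simpa using hk1)
  obtain ⟨ρ, hρ⟩ : ∃ ρ : ℚ, ρ = (u ^ 2 + 2) / (2 * v + u) := ⟨_, rfl⟩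
  have hρ2 : ρ = ((u.num ^ 2 + 2 * (u.den : ℤ) ^ 2 : ℤ) : ℚ) / (k : ℚ) := by
    rw [hρ]; push_cast; rw [← hk1, ← hx]; field_simp
  obtain ⟨c, hc1, hc2⟩ := Rat.num_den_mk (q := ρ) hk0 (by rw [Rat.divInt_eq_div]; exact hρ2)
  have hc6 := gcd_six _ _ k c hcop hk2 ⟨_, hc1⟩ ⟨_, hc2⟩
  have hcabs : |c| ≤ 6 := by
    have := Int.le_of_dvd (by norm_num) ((abs_dvd _ _).mpr hc6); exact this
  have hc36 : c ^ 2 ≤ 36 := by rw [← sq_abs]; nlinarith [abs_nonneg c]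
  have hnum : ((u ^ 2 + 2) ^ 2 / (2 * v + u) ^ 2).num = ρ.num ^ 2 := by
    rw [← div_pow, ← hρ, Rat.num_pow]
  have h1 : ρ.num ^ 2 ≤ hq ((u ^ 2 + 2) ^ 2 / (2 * v + u) ^ 2) := by
    unfold hq; rw [hnum]; exact (le_abs_self _).trans (le_max_left _ _)
  have h2 : hq u ^ 2 ≤ u.num ^ 2 + 2 * (u.den : ℤ) ^ 2 := by
    unfold hq
    rcases max_cases |u.num| (u.den : ℤ) with ⟨h, -⟩ | ⟨h, -⟩ <;> rw [h]
    · rw [sq_abs]; nlinarith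
    · nlinarith [sq_nonneg u.num]
  calc hq u ^ 4 = (hq u ^ 2) ^ 2 := by ring
    _ ≤ (u.num ^ 2 + 2 * (u.den : ℤ) ^ 2) ^ 2 := pow_le_pow_left₀ (by positivity) h2 2
    _ = c ^ 2 * ρ.num ^ 2 := by rw [hc1, mul_pow]
    _ ≤ 36 * ρ.num ^ 2 := by nlinarith [sq_nonneg ρ.num]
    _ ≤ _ := by linarith

theorem prim (p₁ q₁ p₂ q₂ w₀ w₁ w₂ : ℤ) (h₁ : IsCoprime p₁ q₁) (h₂ : IsCoprime p₂ q₂)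
    (hq₁ : q₁ ≠ 0) (hq₂ : q₂ ≠ 0)
    (hs : (p₁ * q₂ + p₂ * q₁) * w₀ = w₁ * (q₁ * q₂)) (hp : p₁ * p₂ * w₀ = w₂ * (q₁ * q₂)) :
    ∃ μ : ℤ, w₀ = μ * (q₁ * q₂) ∧ w₁ = μ * (p₁ * q₂ + p₂ * q₁) ∧ w₂ = μ * (p₁ * p₂) := by
  obtain ⟨a₁, b₁, e₁⟩ := h₁
  obtain ⟨a₂, b₂, e₂⟩ := h₂
  have hB : ∃ a b c : ℤ, a * (q₁ * q₂) + b * (p₁ * q₂ + p₂ * q₁) + c * (p₁ * p₂) = 1 := by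
    obtain ⟨d, hd⟩ : ∃ d, d = a₁ * b₂ - b₁ * a₂ := ⟨_, rfl⟩
    obtain ⟨r, hr⟩ : ∃ r, r = p₁ * q₂ := ⟨_, rfl⟩
    obtain ⟨i, hi⟩ : ∃ i, i = a₁ * a₂ * (p₁ * p₂) + b₁ * b₂ * (q₁ * q₂)
      + b₁ * a₂ * (p₁ * q₂ + p₂ * q₁) := ⟨_, rfl⟩
    have h1 : i + d * r = 1 := by
      rw [hi, hd, hr]; linear_combination e₁ * (a₂ * p₂ + b₂ * q₂) + e₂
    have h2 : i * (i + 2 * d * r) + d ^ 2 * (r * (p₁ * q₂ + p₂ * q₁) - (q₁ * q₂) * (p₁ * p₂)) = 1 := by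
      have : (i + d * r) ^ 2 = 1 := by rw [h1]; norm_num
      rw [← this, hr]; ring
    refine ⟨b₁ * b₂ * (i + 2 * d * r) - d ^ 2 * (p₁ * p₂), b₁ * a₂ * (i + 2 * d * r) + d ^ 2 * r,
      a₁ * a₂ * (i + 2 * d * r), ?_⟩
    linear_combination h2 - (i + 2 * d * r) * hi
  obtain ⟨a, b, c, e⟩ := hB
  have hq : q₁ * q₂ ≠ 0 := mul_ne_zero hq₁ hq₂
  have h0 : w₀ = (a * w₀ + b * w₁ + c * w₂) * (q₁ * q₂) := by
    linear_combination - w₀ * e + b * hs + c * hp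
  refine ⟨a * w₀ + b * w₁ + c * w₂, h0, ?_, ?_⟩
  · apply mul_right_cancel₀ hq
    rw [← hs]; nth_rewrite 1 [h0]; ring
  · apply mul_right_cancel₀ hq
    rw [← hp]; nth_rewrite 1 [h0]; ring

theorem abs_bd (r s N : ℤ) (hN : 0 ≤ N) (hs : |r + s| ≤ 26 * N) (hp : |r * s| ≤ 144 * N ^ 2) :
    |r| ≤ 31 * N := by
  by_contra hlt
  push Not at hlt
  have h1 : |r| ≤ |r + s| + |s| := by
    have := abs_sub (r + s) s; simpa using this
  rw [abs_mul] at hp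
  have h2 : 5 * N < |s| := by linarith
  nlinarith

theorem para (x₁ x₂ : ℚ) (w₀ w₁ w₂ N : ℤ) (hw : w₀ ≠ 0) (hs : (x₁ + x₂) * w₀ = w₁)
    (hp : x₁ * x₂ * w₀ = w₂) (hN : 0 ≤ N) (b0 : |w₀| ≤ 9 * N) (b1 : |w₁| ≤ 26 * N)
    (b2 : |w₂| ≤ 16 * N) : hq x₁ * hq x₂ ≤ 31 * N := by
  have d1 : (x₁.den : ℚ) ≠ 0 := by exact_mod_cast x₁.den_ne_zero
  have d2 : (x₂.den : ℚ) ≠ 0 := by exact_mod_cast x₂.den_ne_zero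
  have n1 : x₁ * x₁.den = x₁.num := Rat.mul_den_eq_num x₁
  have n2 : x₂ * x₂.den = x₂.num := Rat.mul_den_eq_num x₂
  obtain ⟨μ, m0, m1, m2⟩ := prim x₁.num x₁.den x₂.num x₂.den w₀ w₁ w₂ (coprime_nd _) (coprime_nd _)
    (by exact_mod_cast x₁.den_ne_zero) (by exact_mod_cast x₂.den_ne_zero)
    (by
      have : ((x₁.num : ℚ) * x₂.den + x₂.num * x₁.den) * w₀ = w₁ * (x₁.den * x₂.den) := by
        rw [← n1, ← n2, ← hs]; ring
      exact_mod_cast this)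
    (by
      have : ((x₁.num : ℚ) * x₂.num) * w₀ = w₂ * (x₁.den * x₂.den) := by
        rw [← n1, ← n2, ← hp]; ring
      exact_mod_cast this)
  have hμ : 1 ≤ |μ| := by
    apply Int.one_le_abs; rintro rfl; simp at m0; exact hw m0
  have bd : ∀ w v B : ℤ, w = μ * v → |w| ≤ B → |v| ≤ B := by
    intro w v B e hB
    rw [e, abs_mul] at hB
    nlinarith [abs_nonneg v]
  have c0 := bd _ _ _ m0 b0
  have c1 := bd _ _ _ m1 b1
  have c2 := bd _ _ _ m2 b2
  have hprod : |(x₁.num * x₂.den) * (x₂.num * x₁.den)| ≤ 144 * N ^ 2 := by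
    have : (x₁.num * x₂.den) * (x₂.num * x₁.den) = (x₁.den * x₂.den : ℤ) * (x₁.num * x₂.num) := by ring
    rw [this, abs_mul]
    nlinarith [abs_nonneg ((x₁.den * x₂.den : ℤ)), abs_nonneg (x₁.num * x₂.num)]
  have c3 := abs_bd _ _ N hN c1 hprod
  have c4 := abs_bd _ _ N hN (by rw [add_comm]; exact c1) (by rw [mul_comm]; exact hprod)
  unfold hq
  have a1 : |(x₁.den : ℤ)| = x₁.den := abs_of_nonneg (by positivity)
  have a2 : |(x₂.den : ℤ)| = x₂.den := abs_of_nonneg (by positivity)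
  rw [abs_mul] at c0 c2 c3 c4
  rw [a1, a2] at c0
  rw [a2] at c3
  rw [a1] at c4
  rcases max_cases |x₁.num| (x₁.den : ℤ) with ⟨h, -⟩ | ⟨h, -⟩ <;> rw [h] <;>
  rcases max_cases |x₂.num| (x₂.den : ℤ) with ⟨h', -⟩ | ⟨h', -⟩ <;> rw [h']
  · linarith
  · linarith
  · linarith
  · linarith

theorem pair_eq (x y x₀ y₀ : ℚ) (h h₀) (hx : x ≠ x₀) :
    ∃ x1 y1 h1 x2 y2 h2, mk x y h + mk x₀ y₀ h₀ = mk x1 y1 h1 ∧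
      mk x y h - mk x₀ y₀ h₀ = mk x2 y2 h2 ∧
      (x1 + x2) * (x - x₀) ^ 2 = 2 * x * x₀ * (x + x₀) + 5 * x * x₀ - 4 * (x + x₀) ∧
      x1 * x2 * (x - x₀) ^ 2 = (x * x₀ + 2) ^ 2 := by
  have hx' : x - x₀ ≠ 0 := sub_ne_zero.mpr hx
  obtain ⟨l, hl⟩ : ∃ l, l * (x - x₀) = y - y₀ := ⟨(y - y₀) / (x - x₀), by field_simp⟩
  obtain ⟨m, hm⟩ : ∃ m, m * (x - x₀) = y - (-y₀ - x₀) := ⟨(y - (-y₀ - x₀)) / (x - x₀), by field_simp⟩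
  obtain ⟨h1, e1⟩ := mk_add h h₀ hx l hl
  obtain ⟨h2, e2⟩ := mk_add h (by linarith : (-y₀ - x₀) ^ 2 + x₀ * (-y₀ - x₀) = _) hx m hm
  rw [← neg_mk x₀ y₀ h₀, ← sub_eq_add_neg] at e2
  refine ⟨_, _, h1, _, _, h2, e1, e2, ?_, ?_⟩
  · linear_combination (l * (x - x₀) + (y - y₀) + (x - x₀)) * hl
      + (m * (x - x₀) + (y - (-y₀ - x₀)) + (x - x₀)) * hm + 2 * h + 2 * h₀
  · have a1 : (l ^ 2 + l - 1 - x - x₀) * (x - x₀) ^ 2 =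
        (x ^ 3 + x ^ 2 - 2 * x) + (x₀ ^ 3 + x₀ ^ 2 - 2 * x₀) - (1 + x + x₀) * (x - x₀) ^ 2
          - (2 * y * y₀ + x * y₀ + x₀ * y) := by
      linear_combination (l * (x - x₀) + (y - y₀) + (x - x₀)) * hl + h + h₀
    have a2 : (m ^ 2 + m - 1 - x - x₀) * (x - x₀) ^ 2 =
        (x ^ 3 + x ^ 2 - 2 * x) + (x₀ ^ 3 + x₀ ^ 2 - 2 * x₀) - (1 + x + x₀) * (x - x₀) ^ 2
          + (2 * y * y₀ + x * y₀ + x₀ * y) + x * x₀ := by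
      linear_combination (m * (x - x₀) + (y - (-y₀ - x₀)) + (x - x₀)) * hm + h + h₀
    have a3 : (2 * y * y₀ + x * y₀ + x₀ * y) * ((2 * y * y₀ + x * y₀ + x₀ * y) + x * x₀) * 4
        = (4 * (x ^ 3 + x ^ 2 - 2 * x) + x ^ 2) * (4 * (x₀ ^ 3 + x₀ ^ 2 - 2 * x₀) + x₀ ^ 2)
          - x ^ 2 * x₀ ^ 2 := by
      rw [← h, ← h₀]; ring
    apply mul_right_cancel₀ (pow_ne_zero 2 hx')
    have : ∀ A B D : ℚ, A * B * D * D = (A * D) * (B * D) := by intros; ring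
    rw [this, a1, a2]
    linear_combination -a3 / 4

def Gen (R : E.Point) : Prop := ∃ m n : ℤ, R = m • P + n • Q

theorem Gen.add {R S : E.Point} (hR : Gen R) (hS : Gen S) : Gen (R + S) := by
  obtain ⟨m, n, rfl⟩ := hR
  obtain ⟨m', n', rfl⟩ := hS
  exact ⟨m + m', n + n', by rw [add_zsmul, add_zsmul]; abel⟩

theorem Gen.neg {R : E.Point} (hR : Gen R) : Gen (-R) := by
  obtain ⟨m, n, rfl⟩ := hR
  exact ⟨-m, -n, by rw [neg_zsmul, neg_zsmul]; abel⟩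

theorem Gen.of_add {R S : E.Point} (h : Gen (R + S)) (hS : Gen S) : Gen R := by
  have := h.add hS.neg
  rwa [add_neg_cancel_right] at this

theorem gen_zero : Gen 0 := ⟨0, 0, by simp⟩
theorem gen_P : Gen P := ⟨1, 0, by simp⟩
theorem gen_Q : Gen Q := ⟨0, 1, by simp⟩

theorem gen_x {x y x' y' : ℚ} {h h'} (hg : Gen (mk x' y' h')) (hx : x = x') : Gen (mk x y h) := by
  subst hx
  rcases mk_x_eq h h' with e | e
  · rw [e]; exact hg
  · rw [e]; exact hg.neg

theorem gen_dbl {S R : E.Point} (e : R = S + S) (hS : Gen S) : Gen R := e ▸ hS.add hS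

theorem PP_eq : P + P = mk 1 (-1) (by norm_num) ∨ P + P = - mk 1 (-1) (by norm_num) := by
  rw [P_eq]
  obtain ⟨y', h', e⟩ := mk_dbl (x := 2) (y := 2) (by norm_num) (by norm_num)
  have hx : (((2 : ℚ) ^ 2 + 2) ^ 2 / (2 * 2 + 2) ^ 2) = 1 := by norm_num
  rw [e, mk_congr hx rfl]
  exact mk_x_eq _ _

theorem gen_1 : Gen (mk 1 (-1) (by norm_num)) := by
  rcases PP_eq with e | e
  · rw [← e]; exact gen_P.add gen_P
  · rw [← neg_neg (mk 1 (-1) _), ← e]; exact (gen_P.add gen_P).neg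

theorem gen_8 : ∃ y h, Gen (mk 8 y h) := by
  obtain ⟨h', e⟩ := mk_add (x₁ := 2) (y₁ := 2) (x₂ := 1) (y₂ := -1) (by norm_num) (by norm_num)
    (by norm_num) 3 (by norm_num)
  have hx : ((3 : ℚ) ^ 2 + 3 - 1 - 2 - 1) = 8 := by norm_num
  rw [mk_congr hx rfl] at e
  exact ⟨_, _, e ▸ gen_P.add gen_1⟩

theorem gen_addQ {x y : ℚ} {h} (hg : Gen (mk x y h)) (hx : x ≠ 0) : ∃ y' h', Gen (mk (-2 / x) y' h') := by
  obtain ⟨y', h', e⟩ := add_Q x y h hx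
  exact ⟨y', h', e ▸ hg.add gen_Q⟩

theorem fin_small : ∀ p ∈ Finset.Icc (-5 : ℤ) 5, ∀ q ∈ Finset.Icc (1 : ℤ) 5, ∀ k ∈ Finset.range 104,
    (k : ℤ) ^ 2 = p * q * (4 * p ^ 2 + 5 * p * q - 8 * q ^ 2) →
    p = 0 ∨ p = 2 * q ∨ p = -q ∨ p = q ∨ p = -2 * q ∨ 4 * p = -q := by
  decide +kernel

theorem small_case (x y : ℚ) (h) (hM : hq x ≤ 5) : Gen (mk x y h) := by
  obtain ⟨k, -, hk2⟩ := int_k x y h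
  have hn : |x.num| ≤ 5 := (le_max_left _ _).trans hM
  have hd : (x.den : ℤ) ≤ 5 := (le_max_right _ _).trans hM
  have hdp : (1 : ℤ) ≤ x.den := by exact_mod_cast x.den_pos
  have hxe : x * x.den = x.num := Rat.mul_den_eq_num x
  have hd0 : (x.den : ℚ) ≠ 0 := by exact_mod_cast x.den_ne_zero
  have hn' := abs_le.mp hn
  have key := fin_small x.num (Finset.mem_Icc.mpr hn') x.den (Finset.mem_Icc.mpr ⟨hdp, hd⟩)
    k.natAbs (by
      rw [Finset.mem_range]
      have h1 : |x.num * x.den * (4 * x.num ^ 2 + 5 * x.num * x.den - 8 * (x.den : ℤ) ^ 2)| ≤ 25 * 425 := by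
        rw [abs_mul, abs_mul, abs_of_nonneg (by linarith : (0 : ℤ) ≤ x.den)]
        have : |4 * x.num ^ 2 + 5 * x.num * x.den - 8 * (x.den : ℤ) ^ 2| ≤ 425 := by
          rw [abs_le]; constructor <;> nlinarith
        have h3 : |x.num| * x.den ≤ 25 := by nlinarith [abs_nonneg x.num]
        exact mul_le_mul h3 this (abs_nonneg _) (by norm_num)
      rw [← hk2] at h1
      by_contra hc
      push Not at hc
      have : (104 : ℤ) ≤ |k| := by rw [Int.abs_eq_natAbs]; exact_mod_cast hc
      rw [abs_of_nonneg (sq_nonneg k), ← sq_abs] at h1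
      nlinarith) (by rw [Int.natAbs_sq]; exact hk2)
  have aux : ∀ a b : ℤ, (b : ℚ) ≠ 0 → b * x.num = a * x.den → x = a / b := by
    intro a b hb e
    have e' : (b : ℚ) * x.num = a * x.den := by exact_mod_cast e
    rw [← hxe] at e'
    rw [eq_div_iff hb]
    apply mul_right_cancel₀ hd0
    linear_combination e'
  rcases key with e | e | e | e | e | e
  · exact gen_x (Q_eq ▸ gen_Q) ((aux 0 1 (by norm_num) (by omega)).trans (by norm_num))
  · exact gen_x (P_eq ▸ gen_P) ((aux 2 1 (by norm_num) (by omega)).trans (by norm_num))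
  · exact gen_x (PQ_eq ▸ gen_P.add gen_Q) ((aux (-1) 1 (by norm_num) (by omega)).trans (by norm_num))
  · exact gen_x gen_1 ((aux 1 1 (by norm_num) (by omega)).trans (by norm_num))
  · obtain ⟨y', h', g⟩ := gen_addQ gen_1 one_ne_zero
    exact gen_x g ((aux (-2) 1 (by norm_num) (by omega)).trans (by norm_num))
  · obtain ⟨y₁, h₁, g₁⟩ := gen_8
    obtain ⟨y', h', g⟩ := gen_addQ g₁ (by norm_num)
    exact gen_x g ((aux (-1) 4 (by norm_num) (by omega)).trans (by norm_num))

theorem mk_ne_zero (x y : ℚ) (h) : mk x y h ≠ 0 := WeierstrassCurve.Affine.Point.some_ne_zero _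

theorem mk_x_inj {x y x' y' : ℚ} {h h'} (e : mk x y h = mk x' y' h') : x = x' := by
  simp only [mk, WeierstrassCurve.Affine.Point.some.injEq] at e
  exact e.1

theorem pair_height (x x1 x2 : ℚ) (a : ℤ) (ha : a = 2 ∨ a = -1) (hx : x ≠ a)
    (hs : (x1 + x2) * (x - a) ^ 2 = 2 * x * a * (x + a) + 5 * x * a - 4 * (x + a))
    (hp : x1 * x2 * (x - a) ^ 2 = (x * a + 2) ^ 2) : hq x1 * hq x2 ≤ 31 * hq x ^ 2 := by
  have hn : |x.num| ≤ hq x := le_max_left _ _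
  have hd : (x.den : ℤ) ≤ hq x := le_max_right _ _
  have hdp : (0 : ℤ) < x.den := by exact_mod_cast x.den_pos
  have hxe : x * x.den = x.num := Rat.mul_den_eq_num x
  have hd0 : (x.den : ℚ) ≠ 0 := by exact_mod_cast x.den_ne_zero
  have hM := hq_pos x
  obtain ⟨M, hMe⟩ : ∃ M, M = hq x := ⟨_, rfl⟩
  rw [← hMe] at hn hd hM ⊢
  obtain ⟨q, hqe⟩ : ∃ q : ℤ, q = x.den := ⟨_, rfl⟩
  obtain ⟨p, hpe⟩ : ∃ p : ℤ, p = x.num := ⟨_, rfl⟩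
  have hxe' : x * (q : ℚ) = p := by rw [hqe, hpe]; exact_mod_cast hxe
  have hq0 : (q : ℚ) ≠ 0 := by rw [hqe]; exact_mod_cast hd0
  rw [← hpe] at hn
  rw [← hqe] at hd hdp
  clear hxe hd0 hqe hpe hMe
  have hp2 : p ^ 2 ≤ M ^ 2 := by rw [← sq_abs]; nlinarith [abs_nonneg p]
  have hq2 : q ^ 2 ≤ M ^ 2 := by nlinarith
  have hpq : |p * q| ≤ M ^ 2 := by
    rw [abs_mul, abs_of_pos hdp]; nlinarith [abs_nonneg p]
  have hpq' := abs_le.mp hpq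
  have hp0 := sq_nonneg p
  have hqq0 := sq_nonneg q
  apply para x1 x2 ((p - a * q) ^ 2) (2 * a * p ^ 2 + (2 * a ^ 2 + 5 * a - 4) * (p * q) - 4 * a * q ^ 2)
    ((a * p + 2 * q) ^ 2) (M ^ 2)
  · apply pow_ne_zero
    intro h0
    apply hx
    apply mul_right_cancel₀ hq0
    rw [hxe']
    have : p = a * q := by linarith
    rw [this]; push_cast; ring
  · push_cast
    rw [← hxe']
    linear_combination (q : ℚ) ^ 2 * hs
  · push_cast
    rw [← hxe']
    linear_combination (q : ℚ) ^ 2 * hp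
  · positivity
  · rcases ha with rfl | rfl <;> rw [abs_le] <;> constructor <;> nlinarith
  · rcases ha with rfl | rfl <;> rw [abs_le] <;> constructor <;> nlinarith
  · rcases ha with rfl | rfl <;> rw [abs_le] <;> constructor <;> nlinarith

theorem hq_inv (x : ℚ) : hq (-2 / x) ≤ 2 * hq x := by
  by_cases hx : x = 0
  · subst hx; simp [hq]
  have hn : |x.num| ≤ hq x := le_max_left _ _
  have hd : (x.den : ℤ) ≤ hq x := le_max_right _ _
  have hdp : (0 : ℤ) < x.den := by exact_mod_cast x.den_pos
  have hn0 : x.num ≠ 0 := Rat.num_ne_zero.mpr hx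
  have e : -2 / x = ((-2 * x.den : ℤ) : ℚ) / (x.num : ℚ) := by
    push_cast
    rw [← Rat.mul_den_eq_num x]
    have hd0 : (x.den : ℚ) ≠ 0 := by exact_mod_cast x.den_ne_zero
    field_simp
  obtain ⟨c, hc1, hc2⟩ := Rat.num_den_mk (q := -2 / x) hn0 (by rw [Rat.divInt_eq_div]; exact e)
  have hc : 1 ≤ |c| := by
    apply Int.one_le_abs; rintro rfl; simp at hc2; exact hx hc2
  have h1 : |(-2 / x).num| ≤ 2 * hq x := by
    have : |-2 * (x.den : ℤ)| = |c| * |(-2 / x).num| := by rw [hc1, abs_mul]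
    have h2 : |-2 * (x.den : ℤ)| = 2 * x.den := by rw [abs_mul, abs_of_pos hdp]; rfl
    nlinarith [abs_nonneg (-2 / x).num]
  have h2 : ((-2 / x).den : ℤ) ≤ 2 * hq x := by
    have : |x.num| = |c| * ((-2 / x).den : ℤ) := by
      conv_lhs => rw [hc2]
      rw [abs_mul, abs_of_nonneg (by positivity : (0 : ℤ) ≤ (-2 / x).den)]
    have h3 : (0 : ℤ) ≤ (-2 / x).den := by positivity
    nlinarith [hq_pos x]
  exact max_le h1 h2

theorem descend {M : ℤ} (hM : 0 < M) (IH : ∀ u v h, hq u < M → Gen (mk u v h)) (S : E.Point)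
    {x y : ℚ} {h} (e : mk x y h = S + S) (hx : 36 * hq x < M ^ 4) : Gen S := by
  rcases mk_cases S with rfl | ⟨u, v, h', rfl⟩
  · exact gen_zero
  by_cases hv : 2 * v + u = 0
  · rw [mk_dbl_zero h' hv] at e
    exact absurd e (mk_ne_zero _ _ _)
  obtain ⟨y', h'', e'⟩ := mk_dbl h' hv
  rw [e'] at e
  have hxx := mk_x_inj e
  have := dbl_height u v h' hv
  rw [← hxx] at this
  exact IH _ _ _ (lt_of_pow_lt_pow_left₀ 4 hM.le (by linarith))

theorem desc_T {x y : ℚ} {h} (hM : 6 ≤ hq x) (IH : ∀ u v h, hq u < hq x → Gen (mk u v h))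
    (a : ℤ) (ha : a = 2 ∨ a = -1) (b : ℚ) (hab) (hT : Gen (mk a b hab)) (S : E.Point)
    (e : mk x y h + mk a b hab = S + S) : Gen (mk x y h) := by
  have hx : x ≠ a := by
    rintro rfl
    unfold hq at hM
    rcases ha with rfl | rfl <;> simp at hM
  obtain ⟨x1, y1, h1, x2, y2, h2, e1, e2, hs, hp⟩ := pair_eq x y a b h hab hx
  have hh := pair_height x x1 x2 a ha hx hs hp
  by_cases c1 : 36 * hq x1 < hq x ^ 4
  · have := descend (hq_pos x) IH S (e1.symm.trans e) c1
    exact (gen_dbl e this).of_add hT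
  by_cases c2 : 36 * hq x2 < hq x ^ 4
  · have e3 : mk x y h - mk a b hab = (S - mk a b hab) + (S - mk a b hab) := by
      have : mk x y h = S + S - mk a b hab := by rw [← e]; abel
      rw [this]; abel
    have := gen_dbl e3 (descend (hq_pos x) IH _ (e2.symm.trans e3) c2)
    have := this.add hT
    rwa [sub_add_cancel] at this
  exfalso
  push Not at c1 c2
  have hp2 : 36 ≤ hq x ^ 2 := by nlinarith
  obtain ⟨N, hN⟩ : ∃ N, N = hq x ^ 2 := ⟨_, rfl⟩
  have h4 : hq x ^ 4 = N ^ 2 := by rw [hN]; ring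
  rw [← hN] at hh hp2
  rw [h4] at c1 c2
  have h5 : N ^ 2 * N ^ 2 ≤ (36 * hq x1) * (36 * hq x2) :=
    mul_le_mul c1 c2 (by positivity) (by linarith [hq_pos x1])
  have h6 : N ^ 2 * N ^ 2 ≤ 40176 * N := by nlinarith
  have h7 : 1296 ≤ N ^ 2 := by nlinarith
  have h8 : 46656 * N ≤ N ^ 2 * N ^ 2 := by nlinarith
  linarith

theorem gen_mk : ∀ n : ℕ, ∀ x y h, hq x ≤ n → Gen (mk x y h) := by
  intro n
  induction n with
  | zero => intro x y h hx; have := hq_pos x; push_cast at hx; omega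
  | succ n ih =>
    intro x y h hx
    by_cases hM : hq x ≤ 5
    · exact small_case x y h hM
    have hM : 6 ≤ hq x := by omega
    have IH : ∀ u v h, hq u < hq x → Gen (mk u v h) := by
      intro u v h hu; apply ih; push_cast at hx; omega
    have hM3 : 216 ≤ hq x ^ 3 := by
      have := pow_le_pow_left₀ (by norm_num) hM 3; simpa using this
    have hM4 : 216 * hq x ≤ hq x ^ 4 := by
      have : hq x ^ 4 = hq x ^ 3 * hq x := by ring
      rw [this]; nlinarith
    have hx0 : x ≠ 0 := by
      rintro rfl; simp [hq] at hM
    obtain ⟨S, e | e | e | e⟩ := four_cosets (mk x y h)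
    · exact gen_dbl e (descend (hq_pos x) IH S e (by linarith))
    · obtain ⟨y', h', e'⟩ := add_Q x y h hx0
      exact (gen_dbl e (descend (hq_pos x) IH S (e'.symm.trans e) (by linarith [hq_inv x]))).of_add gen_Q
    · exact desc_T hM IH 2 (Or.inl rfl) 2 (by norm_num) (by exact_mod_cast P_eq ▸ gen_P) S
        (by exact_mod_cast P_eq ▸ e)
    · exact desc_T hM IH (-1) (Or.inr rfl) 2 (by norm_num) (by exact_mod_cast PQ_eq ▸ gen_P.add gen_Q) S
        (by exact_mod_cast PQ_eq ▸ e)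

theorem gen_all (R : E.Point) : Gen R := by
  rcases mk_cases R with rfl | ⟨x, y, h, rfl⟩
  · exact gen_zero
  · exact gen_mk (hq x).toNat x y h (Int.self_le_toNat _)

theorem dbl_step {x y : ℚ} (h) (hM : 9 ≤ hq x) :
    ∃ x' y' h', mk x y h + mk x y h = mk x' y' h' ∧ hq x < hq x' := by
  have hv : 2 * y + x ≠ 0 := by
    intro hv
    obtain ⟨k, hk1, hk2⟩ := int_k x y h
    have hy : y = -x / 2 := by linarith
    rw [hy] at h
    have h3 : x * (4 * x ^ 2 + 5 * x - 8) = 0 := by linear_combination -4 * h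
    rcases mul_eq_zero.mp h3 with h4 | h4
    · rw [h4] at hM; simp [hq] at hM
    · have h5 : (8 * x + 5) * (8 * x + 5) = ((153 : ℤ) : ℚ) := by push_cast; linear_combination 16 * h4
      have : IsSquare (((153 : ℤ) : ℚ)) := ⟨_, h5.symm⟩
      rw [Rat.isSquare_intCast_iff] at this
      obtain ⟨r, hr⟩ := this
      have h6 : r < 13 := by nlinarith
      have h7 : -13 < r := by nlinarith
      interval_cases r <;> omega
  obtain ⟨y', h', e⟩ := mk_dbl h hv
  refine ⟨_, y', h', e, ?_⟩
  have := dbl_height x y h hv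
  have hM3 : 729 ≤ hq x ^ 3 := by
    have := pow_le_pow_left₀ (by norm_num) hM 3; simpa using this
  have hM4 : 729 * hq x ≤ hq x ^ 4 := by
    have : hq x ^ 4 = hq x ^ 3 * hq x := by ring
    rw [this]; nlinarith
  linarith

theorem four_P : ∃ y h, (4 : ℕ) • P = mk 9 y h := by
  have e : (4 : ℕ) • P = (P + P) + (P + P) := by abel
  obtain ⟨y', h', e'⟩ := mk_dbl (x := 1) (y := -1) (by norm_num) (by norm_num)
  have hx : (((1 : ℚ) ^ 2 + 2) ^ 2 / (2 * (-1) + 1) ^ 2) = 9 := by norm_num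
  rw [mk_congr hx rfl] at e'
  rcases PP_eq with h | h
  · rw [e, h]; exact ⟨_, _, e'⟩
  · rw [e, h, ← neg_add, e', neg_mk]; exact ⟨_, _, rfl⟩

theorem pow_P (j : ℕ) : ∃ x y h, (2 ^ j * 4) • P = mk x y h ∧ (9 + j : ℤ) ≤ hq x := by
  induction j with
  | zero =>
    obtain ⟨y, h, e⟩ := four_P
    exact ⟨9, y, h, by simpa using e, by simp [hq]⟩
  | succ j ih =>
    obtain ⟨x, y, h, e, hh⟩ := ih
    obtain ⟨x', y', h', e', hh'⟩ := dbl_step h (by omega)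
    refine ⟨x', y', h', ?_, by push_cast; omega⟩
    rw [← e', ← e, ← add_nsmul]; congr 1; ring

def hgt : E.Point → ℤ
  | .zero => 0
  | .some x _ _ => hq x

theorem hgt_nonneg (R : E.Point) : 0 ≤ hgt R := by
  rcases R with _ | ⟨x, y, h⟩
  · exact le_refl _
  · exact (hq_pos x).le

theorem order_P : addOrderOf P = 0 := by
  by_contra hn
  have hpos : 0 < addOrderOf P := Nat.pos_of_ne_zero hn
  obtain ⟨B, hB⟩ : ∃ B, B = ∑ i ∈ Finset.range (addOrderOf P), hgt (i • P) := ⟨_, rfl⟩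
  have bd : ∀ k : ℕ, hgt (k • P) ≤ B := by
    intro k
    rw [← mod_addOrderOf_nsmul, hB]
    exact Finset.single_le_sum (f := fun i : ℕ => hgt (i • P)) (fun i _ => hgt_nonneg _)
      (Finset.mem_range.mpr (Nat.mod_lt _ hpos))
  obtain ⟨x, y, h, e, hh⟩ := pow_P B.toNat
  have h1 := bd (2 ^ B.toNat * 4)
  rw [e] at h1
  have h2 : hgt (mk x y h) = hq x := rfl
  omega

theorem order_Q : addOrderOf Q = 2 := by
  apply addOrderOf_eq_prime
  · rw [two_nsmul, QQ]
  · rw [Q_eq]; exact mk_ne_zero _ _ _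

theorem mP_zero (m : ℤ) (h : m • P = 0) : m = 0 := by
  have := addOrderOf_dvd_iff_zsmul_eq_zero.mpr h
  rw [order_P] at this
  simpa using this

theorem rep (X : E.Point) : ∃ (m : ℤ) (n : ℕ), n ∈ ({0, 1} : Set ℕ) ∧ X = m • P + n • Q := by
  obtain ⟨m, n, e⟩ := gen_all X
  have hk : ∀ k : ℤ, (2 * k) • Q = 0 := by
    intro k
    rw [two_mul, add_zsmul, ← zsmul_add, QQ, zsmul_zero]
  rcases Int.even_or_odd' n with ⟨k, rfl | rfl⟩
  · refine ⟨m, 0, by simp, ?_⟩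
    rw [e, hk k]; simp
  · refine ⟨m, 1, by simp, ?_⟩
    rw [e, add_zsmul, hk k]; simp

noncomputable def isoHom : ℤ × ZMod 2 →+ E.Point :=
  AddMonoidHom.coprod (zmultiplesHom _ P)
    (ZMod.lift 2 ⟨zmultiplesHom _ Q, by
      rw [zmultiplesHom_apply, Nat.cast_ofNat, two_zsmul, QQ]⟩)

theorem isoHom_apply (m n : ℤ) : isoHom (m, (n : ZMod 2)) = m • P + n • Q := by
  simp [isoHom]

theorem isoHom_bij : Function.Bijective isoHom := by
  constructor
  · rw [injective_iff_map_eq_zero]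
    rintro ⟨m, z⟩ h
    obtain ⟨n, rfl⟩ := ZMod.intCast_surjective z
    rw [isoHom_apply] at h
    have h2 : (2 * m) • P = 0 := by
      have : (2 * m) • P = (m • P + n • Q) + (m • P + n • Q) - n • (Q + Q) := by
        rw [two_mul, add_zsmul, zsmul_add]; abel
      rw [this, h, QQ, zsmul_zero]; simp
    have hm : m = 0 := by have := mP_zero _ h2; omega
    subst hm
    rw [zero_zsmul, zero_add] at h
    have := addOrderOf_dvd_iff_zsmul_eq_zero.mpr h
    rw [order_Q] at this
    have : (n : ZMod 2) = 0 := (ZMod.intCast_zmod_eq_zero_iff_dvd n 2).mpr this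
    rw [this]; rfl
  · intro X
    obtain ⟨m, n, e⟩ := gen_all X
    exact ⟨(m, (n : ZMod 2)), by rw [isoHom_apply, e]⟩

theorem mordell_weil_group_of_E :
    Nonempty (E.Point ≃+ ℤ × ZMod 2) ∧
    addOrderOf P = 0 ∧
    addOrderOf Q = 2 ∧
    ∀ X : E.Point, ∃ (m : ℤ) (n : ℕ), n ∈ ({0, 1} : Set ℕ) ∧ X = m • P + n • Q := by
  exact ⟨⟨(AddEquiv.ofBijective isoHom isoHom_bij).symm⟩, order_P, order_Q, rep⟩
end
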